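/- Let A be a sequence algebra and X an essential homogeneous Banach A-module. Then X is extremely projective with respect to the class H̄ of all essential homogeneous Banach A-modules if and only if for every n ∈ ℕ the n-th coordinate subspace Xₙ is isometrically isomorphic to l₁(Λₙ) for some index set Λₙ. -/

import Mathlib

noncomputable section

open Filter Topology

/-- A coisometric (quotient) bounded operator between complex normed spaces. -/
def IsCoisometry {Y X : Type} [NormedAddCommGroup Y] [NormedSpace ℂ Y]
    [NormedAddCommGroup X] [NormedSpace ℂ X] (τ : Y →L[ℂ] X) : Prop :=
  (∀ y : Y, ‖τ y‖ ≤ ‖y‖) ∧ ∀ x : X, ∀ ε : ℝ, 0 < ε → ∃ y : Y, τ y = x ∧ ‖y‖ < ‖x‖ + ε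

/-- Extreme (metric) projectivity in the category Nor of all complex normed spaces. -/
def ExtremelyProjectiveNor (P : Type) [NormedAddCommGroup P] [NormedSpace ℂ P] : Prop :=
  ∀ (Y X : Type) [NormedAddCommGroup Y] [NormedSpace ℂ Y]
    [NormedAddCommGroup X] [NormedSpace ℂ X],
    ∀ τ : Y →L[ℂ] X, IsCoisometry τ →
      ∀ φ : P →L[ℂ] X, ∀ ε : ℝ, 0 < ε →
        ∃ ψ : P →L[ℂ] Y, τ.comp ψ = φ ∧ ‖ψ‖ < ‖φ‖ + ε

/-- Topological projectivity in Nor. -/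
def TopologicallyProjectiveNor (P : Type) [NormedAddCommGroup P] [NormedSpace ℂ P] : Prop :=
  ∀ (Y X : Type) [NormedAddCommGroup Y] [NormedSpace ℂ Y]
    [NormedAddCommGroup X] [NormedSpace ℂ X],
    ∀ τ : Y →L[ℂ] X, IsCoisometry τ →
      ∀ φ : P →L[ℂ] X, ∃ ψ : P →L[ℂ] Y, τ.comp ψ = φ

/-- A (contractive, non-degenerate in no way assumed) normed left module over a
(not necessarily unital) complex normed algebra `A`. -/
structure NormedMod (A : Type) [NonUnitalNormedRing A] [NormedSpace ℂ A] : Type 1 where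
  X : Type
  [grp : NormedAddCommGroup X]
  [sp : NormedSpace ℂ X]
  smul : A → X → X
  smul_add : ∀ (a : A) (x y : X), smul a (x + y) = smul a x + smul a y
  add_smul : ∀ (a b : A) (x : X), smul (a + b) x = smul a x + smul b x
  smul_csmul : ∀ (c : ℂ) (a : A) (x : X), smul a (c • x) = c • smul a x
  csmul_smul : ∀ (c : ℂ) (a : A) (x : X), smul (c • a) x = c • smul a x
  mul_smul : ∀ (a b : A) (x : X), smul (a * b) x = smul a (smul b x)
  norm_smul_le : ∀ (a : A) (x : X), ‖smul a x‖ ≤ ‖a‖ * ‖x‖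

attribute [instance] NormedMod.grp NormedMod.sp

variable {A : Type} [NonUnitalNormedRing A] [NormedSpace ℂ A]
  [IsScalarTower ℂ A A] [SMulCommClass ℂ A A]

/-- Bounded `A`-module morphism property for a bounded operator between the underlying spaces. -/
def IsMor (M N : NormedMod A) (f : M.X →L[ℂ] N.X) : Prop :=
  ∀ (a : A) (x : M.X), f (M.smul a x) = N.smul a (f x)

/-- Extreme (metric) projectivity of a normed `A`-module with respect to a class `K`
of normed `A`-modules. -/
def ExtremelyProjective (P : NormedMod A) (K : NormedMod A → Prop) : Prop :=
  ∀ (MY MX : NormedMod A), K MY → K MX →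
    ∀ τ : MY.X →L[ℂ] MX.X, IsMor MY MX τ → IsCoisometry τ →
      ∀ φ : P.X →L[ℂ] MX.X, IsMor P MX φ → ∀ ε : ℝ, 0 < ε →
        ∃ ψ : P.X →L[ℂ] MY.X, IsMor P MY ψ ∧ τ.comp ψ = φ ∧ ‖ψ‖ < ‖φ‖ + ε

/-- Topological projectivity of a normed `A`-module with respect to a class `K`. -/
def TopologicallyProjective (P : NormedMod A) (K : NormedMod A → Prop) : Prop :=
  ∀ (MY MX : NormedMod A), K MY → K MX →
    ∀ τ : MY.X →L[ℂ] MX.X, IsMor MY MX τ → IsCoisometry τ →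
      ∀ φ : P.X →L[ℂ] MX.X, IsMor P MX φ →
        ∃ ψ : P.X →L[ℂ] MY.X, IsMor P MY ψ ∧ τ.comp ψ = φ

/-- A sequence algebra: a normed algebra `A` realized (injectively, by `coords`) as an
algebra of complex sequences with coordinatewise operations, containing the elements
`p n` (the sequences with a single entry `1` in position `n`, which span `c₀₀`) so that
`c₀₀` is dense and `‖p n‖ = 1`. -/
structure SequenceAlgebra (A : Type) [NonUnitalNormedRing A] [NormedSpace ℂ A] : Type where
  coords : A →ₗ[ℂ] (ℕ → ℂ)
  coords_injective : Function.Injective coords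
  coords_mul : ∀ a b : A, coords (a * b) = coords a * coords b
  p : ℕ → A
  coords_p : ∀ n : ℕ, coords (p n) = fun m => if m = n then (1 : ℂ) else 0
  norm_p : ∀ n : ℕ, ‖p n‖ = 1
  dense_c00 : Dense (↑(Submodule.span ℂ (Set.range p)) : Set A)

variable (SA : SequenceAlgebra A)

/-- The action of a fixed `a : A` as a `ℂ`-linear map on a normed `A`-module. -/
def NormedMod.smulLM (M : NormedMod A) (a : A) : M.X →ₗ[ℂ] M.X where
  toFun := M.smul a
  map_add' := M.smul_add a
  map_smul' := fun c x => M.smul_csmul c a x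

/-- The `n`-th coordinate subspace `Xₙ = {pⁿ · x : x ∈ X}` of a normed `A`-module. -/
def coordSub (M : NormedMod A) (n : ℕ) : Submodule ℂ M.X :=
  LinearMap.range (M.smulLM (SA.p n))

/-- A normed `A`-module is essential (non-degenerate) if the closed linear span of
`{a · x}` is everything. -/
def NormedMod.Essential (M : NormedMod A) : Prop :=
  Dense (↑(Submodule.span ℂ {y : M.X | ∃ (a : A) (x : M.X), y = M.smul a x}) : Set M.X)

/-- Homogeneity: the norm of an element is monotonely determined by the norms of
its coordinates. -/
def Homogeneous (M : NormedMod A) : Prop :=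
  ∀ x y : M.X, (∀ n : ℕ, ‖M.smul (SA.p n) x‖ ≤ ‖M.smul (SA.p n) y‖) → ‖x‖ ≤ ‖y‖

/-- An element is finite if its coordinates eventually vanish. -/
def FiniteElt (M : NormedMod A) (x : M.X) : Prop :=
  ∃ N : ℕ, ∀ n : ℕ, N ≤ n → M.smul (SA.p n) x = 0

/-- A module has finite type if all its elements are finite, i.e. `X = X₀₀`. -/
def FiniteType (M : NormedMod A) : Prop :=
  ∀ x : M.X, FiniteElt SA M x


instance : Fact ((1 : ENNReal) ≤ 1) := ⟨le_rfl⟩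

/-- The Banach space `l₁(Λ)` of absolutely summable complex functions on `Λ`. -/
abbrev l1Space (Λ : Type) : Type := lp (fun _ : Λ => ℂ) 1

/-! ### The space `l₁(Λ)` -/

section l1

variable {Λ : Type} {E : Type} [NormedAddCommGroup E] [NormedSpace ℂ E]

lemma l1Space.hasSum_norm (c : l1Space Λ) : HasSum (fun i => ‖c i‖) ‖c‖ := by
  have h := lp.hasSum_norm (p := 1) (by simp) c
  simpa using h

lemma l1Space.summable_norm (c : l1Space Λ) : Summable (fun i => ‖c i‖) :=
  (l1Space.hasSum_norm c).summable

lemma l1Space.summable_smul [CompleteSpace E] {y : Λ → E} {C : ℝ} (hy : ∀ i, ‖y i‖ ≤ C)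
    (c : l1Space Λ) : Summable (fun i => c i • y i) := by
  refine Summable.of_norm_bounded ((l1Space.summable_norm c).mul_right C) fun i => ?_
  rw [norm_smul]
  exact mul_le_mul_of_nonneg_left (hy i) (norm_nonneg _)

/-- The operator on `l₁(Λ)` determined by a bounded family in a Banach space. -/
def l1Lift [CompleteSpace E] (y : Λ → E) (C : ℝ) (hy : ∀ i, ‖y i‖ ≤ C) : l1Space Λ →L[ℂ] E :=
  LinearMap.mkContinuous
    { toFun := fun c => ∑' i, c i • y i
      map_add' := fun c d => by
        rw [← (l1Space.summable_smul hy c).tsum_add (l1Space.summable_smul hy d)]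
        simp only [lp.coeFn_add, Pi.add_apply, add_smul]
      map_smul' := fun a c => by
        rw [RingHom.id_apply, ← (l1Space.summable_smul hy c).tsum_const_smul a]
        simp only [lp.coeFn_smul, Pi.smul_apply, smul_assoc] } C
    fun c => by
      refine tsum_of_norm_bounded ((l1Space.hasSum_norm c).mul_left C) fun i => ?_
      rw [norm_smul, mul_comm]
      exact mul_le_mul_of_nonneg_right (hy i) (norm_nonneg _)

section

variable [CompleteSpace E] {y : Λ → E} {C : ℝ} (hy : ∀ i, ‖y i‖ ≤ C)

lemma l1Lift_hasSum (c : l1Space Λ) : HasSum (fun i => c i • y i) (l1Lift y C hy c) :=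
  (l1Space.summable_smul hy c).hasSum

lemma norm_l1Lift_le (c : l1Space Λ) : ‖l1Lift y C hy c‖ ≤ C * ‖c‖ := by
  refine tsum_of_norm_bounded ((l1Space.hasSum_norm c).mul_left C) fun i => ?_
  rw [norm_smul, mul_comm]
  exact mul_le_mul_of_nonneg_right (hy i) (norm_nonneg _)

lemma l1Lift_single [DecidableEq Λ] (i : Λ) (a : ℂ) : l1Lift y C hy (lp.single 1 i a) = a • y i := by
  refine (l1Lift_hasSum hy _).unique ?_
  convert hasSum_ite_eq i (a • y i) using 2 with j
  by_cases h : j = i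
  · subst h; simp
  · simp [h]

end

lemma l1Space.hasSum_single [DecidableEq Λ] (c : l1Space Λ) :
    HasSum (fun i => c i • (lp.single 1 i 1 : l1Space Λ)) c := by
  have h := lp.hasSum_single (p := 1) (by simp) c
  refine h.congr_fun fun i => ?_
  rw [← lp.single_smul, smul_eq_mul, mul_one]

lemma l1Space.norm_single [DecidableEq Λ] (i : Λ) (a : ℂ) :
    ‖(lp.single 1 i a : l1Space Λ)‖ = ‖a‖ :=
  lp.norm_single (E := fun _ : Λ => ℂ) (p := 1) zero_lt_one i a

end l1

/-! ### Almost isometric sections of the canonical quotient map `l₁(S) → P` -/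

section WeightedSum

variable {P : Type} [NormedAddCommGroup P] [NormedSpace ℂ P] {S : Type}

/-- The integral of `g` against the total variation of `J v`. -/
def wSum (J : P →L[ℂ] l1Space S) (v : P) (g : S → ℝ) : ℝ := ∑' t, ‖J v t‖ * g t

variable {J : P →L[ℂ] l1Space S} {v w : P} {g g' : S → ℝ} {G G' : ℝ}

lemma wSum_summable (J : P →L[ℂ] l1Space S) (v : P) (hg : ∀ t, |g t| ≤ G) :
    Summable (fun t => ‖J v t‖ * g t) := by
  refine Summable.of_norm_bounded ((l1Space.summable_norm (J v)).mul_right G) fun t => ?_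
  rw [norm_mul, norm_norm]
  exact mul_le_mul_of_nonneg_left (hg t) (norm_nonneg _)

lemma wSum_const (a : ℝ) : wSum J v (fun _ => a) = a * ‖J v‖ := by
  rw [wSum, tsum_mul_right, (l1Space.hasSum_norm (J v)).tsum_eq, mul_comm]

lemma wSum_add (hg : ∀ t, |g t| ≤ G) (hg' : ∀ t, |g' t| ≤ G') :
    wSum J v (fun t => g t + g' t) = wSum J v g + wSum J v g' := by
  simp only [wSum, mul_add]
  exact (wSum_summable J v hg).tsum_add (wSum_summable J v hg')

lemma wSum_sub (hg : ∀ t, |g t| ≤ G) (hg' : ∀ t, |g' t| ≤ G') :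
    wSum J v (fun t => g t - g' t) = wSum J v g - wSum J v g' := by
  simp only [wSum, mul_sub]
  exact (wSum_summable J v hg).tsum_sub (wSum_summable J v hg')

lemma wSum_const_mul (a : ℝ) : wSum J v (fun t => a * g t) = a * wSum J v g := by
  rw [wSum, wSum, ← tsum_mul_left]
  exact tsum_congr fun t => by ring

lemma wSum_mono (hg : ∀ t, |g t| ≤ G) (hg' : ∀ t, |g' t| ≤ G') (h : ∀ t, g t ≤ g' t) :
    wSum J v g ≤ wSum J v g' :=
  (wSum_summable J v hg).tsum_le_tsum (fun t => mul_le_mul_of_nonneg_left (h t) (norm_nonneg _))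
    (wSum_summable J v hg')

lemma wSum_finsetSum {ι : Type*} (F : Finset ι) {g : ι → S → ℝ} {G : ι → ℝ}
    (hg : ∀ i ∈ F, ∀ t, |g i t| ≤ G i) :
    wSum J v (fun t => ∑ i ∈ F, g i t) = ∑ i ∈ F, wSum J v (g i) := by
  simp only [wSum, Finset.mul_sum]
  exact Summable.tsum_finsetSum fun i hi => wSum_summable J v (hg i hi)

lemma wSum_nonneg (hg : ∀ t, 0 ≤ g t) : 0 ≤ wSum J v g :=
  tsum_nonneg fun t => mul_nonneg (norm_nonneg _) (hg t)

lemma wSum_le (hg : ∀ t, |g t| ≤ G) : wSum J v g ≤ G * ‖J v‖ := by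
  rcases isEmpty_or_nonempty S with h | ⟨⟨t⟩⟩
  · have : ‖J v‖ = 0 := by rw [← (l1Space.hasSum_norm (J v)).tsum_eq, tsum_empty]
    rw [this, wSum, tsum_empty, mul_zero]
  · rw [← wSum_const]
    exact wSum_mono (G' := |G|) hg (fun _ => le_rfl) fun t => (le_abs_self _).trans (hg t)

lemma wSum_add_left_le (hg0 : ∀ t, 0 ≤ g t) (hg : ∀ t, |g t| ≤ G) :
    wSum J (v + w) g ≤ wSum J v g + wSum J w g := by
  rw [wSum, wSum, wSum, ← (wSum_summable J v hg).tsum_add (wSum_summable J w hg)]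
  refine (wSum_summable J _ hg).tsum_le_tsum (fun t => ?_)
    ((wSum_summable J v hg).add (wSum_summable J w hg))
  rw [← add_mul, map_add]
  exact mul_le_mul_of_nonneg_right (norm_add_le _ _) (hg0 t)

lemma wSum_smul_left (a : ℂ) : wSum J (a • v) g = ‖a‖ * wSum J v g := by
  rw [wSum, wSum, ← tsum_mul_left]
  refine tsum_congr fun t => ?_
  rw [map_smul, lp.coeFn_smul, Pi.smul_apply, norm_smul, mul_assoc]

lemma wSum_sum_left_le (hg0 : ∀ t, 0 ≤ g t) (hg : ∀ t, |g t| ≤ G) {ι : Type*} (F : Finset ι)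
    (y : ι → P) : wSum J (∑ i ∈ F, y i) g ≤ ∑ i ∈ F, wSum J (y i) g := by
  classical
  induction F using Finset.induction_on with
  | empty => simp [wSum]
  | insert a F ha ih =>
    rw [Finset.sum_insert ha, Finset.sum_insert ha]
    exact (wSum_add_left_le hg0 hg).trans (by gcongr)

end WeightedSum

section Sections

lemma norm_sphere {P : Type} [NormedAddCommGroup P] (s : Metric.sphere (0 : P) 1) :
    ‖(s : P)‖ = 1 :=
  mem_sphere_zero_iff_norm.1 s.2

variable {P : Type} [NormedAddCommGroup P] [NormedSpace ℂ P]

/-- `J` is a section, of norm at most `1 + ε`, of the canonical map `l₁(S) → P`, where `S` is the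
unit sphere of `P`. -/
structure IsSection (J : P →L[ℂ] l1Space (Metric.sphere (0 : P) 1)) (ε : ℝ) : Prop where
  nonneg : 0 ≤ ε
  le_one : ε ≤ 1
  norm_le : ∀ v, ‖J v‖ ≤ (1 + ε) * ‖v‖
  hasSum : ∀ v, HasSum (fun s : Metric.sphere (0 : P) 1 => J v s • (s : P)) v

variable {J K : P →L[ℂ] l1Space (Metric.sphere (0 : P) 1)} {ε κ : ℝ}
  {x v w : P} {g : Metric.sphere (0 : P) 1 → ℝ} {G : ℝ}

namespace IsSection

lemma norm_le_two (hJ : IsSection J ε) (v : P) : ‖J v‖ ≤ 2 * ‖v‖ :=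
  (hJ.norm_le v).trans (mul_le_mul_of_nonneg_right (by linarith [hJ.le_one]) (norm_nonneg _))

lemma norm_le_sphere (hJ : IsSection J ε) (s : Metric.sphere (0 : P) 1) : ‖J s‖ ≤ 1 + ε := by
  simpa [norm_sphere] using hJ.norm_le s

lemma le_norm (hJ : IsSection J ε) (v : P) : ‖v‖ ≤ ‖J v‖ := by
  have h := tsum_of_norm_bounded (l1Space.hasSum_norm (J v))
    (f := fun s : Metric.sphere (0 : P) 1 => J v s • (s : P))
    fun s => by rw [norm_smul, norm_sphere, mul_one]
  rwa [(hJ.hasSum v).tsum_eq] at h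

lemma abs_wSum_le (hK : IsSection K κ) (hg : ∀ t, |g t| ≤ G) (s : Metric.sphere (0 : P) 1) :
    |wSum K s g| ≤ 2 * G := by
  have hG : 0 ≤ G := (abs_nonneg _).trans (hg s)
  have h1 : ‖K s‖ ≤ 2 := by simpa [norm_sphere] using hK.norm_le_two s
  have h2 := wSum_le (J := K) (v := s) hg
  have h3 := wSum_le (J := K) (v := s) (g := fun t => (-1) * g t) (G := G) (by simpa using hg)
  rw [wSum_const_mul] at h3
  rw [abs_le]
  constructor <;> nlinarith

/-- Integrals are subadditive along the barycentric decomposition given by a section. -/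
lemma wSum_le_wSum_wSum (hJ : IsSection J ε) (hK : IsSection K κ) (hg0 : ∀ t, 0 ≤ g t)
    (hg : ∀ t, |g t| ≤ G) (x : P) : wSum K x g ≤ wSum J x (fun s => wSum K s g) := by
  have hlim : Tendsto (fun F : Finset (Metric.sphere (0 : P) 1) =>
      wSum J x (fun s => wSum K s g) + G * (2 * ‖x - ∑ s ∈ F, J x s • (s : P)‖)) atTop
      (𝓝 (wSum J x (fun s => wSum K s g) + G * (2 * ‖x - x‖))) :=
    (((tendsto_const_nhds.sub (hJ.hasSum x)).norm.const_mul 2).const_mul G).const_add _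
  rw [sub_self, norm_zero, mul_zero, mul_zero, add_zero] at hlim
  refine ge_of_tendsto' hlim fun F => ?_
  have h1 : wSum K x g ≤ wSum K (∑ s ∈ F, J x s • (s : P)) g
      + wSum K (x - ∑ s ∈ F, J x s • (s : P)) g := by
    simpa using wSum_add_left_le (J := K) (v := ∑ s ∈ F, J x s • (s : P))
      (w := x - ∑ s ∈ F, J x s • (s : P)) hg0 hg
  have h2 : wSum K (∑ s ∈ F, J x s • (s : P)) g ≤ wSum J x (fun s => wSum K s g) := by
    refine (wSum_sum_left_le hg0 hg F _).trans ?_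
    simp only [wSum_smul_left]
    exact (wSum_summable J x (hK.abs_wSum_le hg)).sum_le_tsum F
      fun s _ => mul_nonneg (norm_nonneg _) (wSum_nonneg hg0)
  have h3 : wSum K (x - ∑ s ∈ F, J x s • (s : P)) g
      ≤ G * (2 * ‖x - ∑ s ∈ F, J x s • (s : P)‖) := by
    refine (wSum_le hg).trans ?_
    rcases isEmpty_or_nonempty (Metric.sphere (0 : P) 1) with h | ⟨⟨t⟩⟩
    · have h0 : ∀ v, ‖K v‖ = 0 := fun v => by
        rw [← (l1Space.hasSum_norm (K v)).tsum_eq, tsum_empty]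
      have hx : ∀ v : P, ‖v‖ = 0 := fun v =>
        le_antisymm ((hK.le_norm v).trans (h0 v).le) (norm_nonneg _)
      rw [h0, hx]
      simp
    · exact mul_le_mul_of_nonneg_left (hK.norm_le_two _) ((abs_nonneg _).trans (hg t))
  linarith

/-- Applying a section twice hardly increases the integral of a bounded function. -/
lemma wSum_wSum_le (hJ : IsSection J ε) (hg0 : ∀ t, 0 ≤ g t) (hg : ∀ t, |g t| ≤ G)
    (hx : ‖x‖ = 1) : wSum J x (fun s => wSum J s g) ≤ wSum J x g + 3 * ε * G := by
  have hG : 0 ≤ G := (abs_nonneg _).trans (hg ⟨x, mem_sphere_zero_iff_norm.2 hx⟩)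
  have hgG : ∀ t, g t ≤ G := fun t => (le_abs_self _).trans (hg t)
  have hc : ∀ t : Metric.sphere (0 : P) 1, |(fun _ => G) t| ≤ G := fun _ => (abs_of_nonneg hG).le
  have hc2 : ∀ t : Metric.sphere (0 : P) 1, |G * (1 + ε)| ≤ G * (1 + ε) :=
    fun _ => (abs_of_nonneg (mul_nonneg hG (by linarith [hJ.nonneg]))).le
  have hGg : ∀ t, |G - g t| ≤ G := fun t => by
    rw [abs_of_nonneg (by linarith [hgG t])]; linarith [hg0 t]
  have h1 := hJ.wSum_le_wSum_wSum hJ (g := fun t => G - g t) (G := G)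
    (fun t => by linarith [hgG t]) hGg x
  have h2 : wSum J x (fun s => wSum J s (fun t => G - g t))
      ≤ wSum J x (fun s => G * (1 + ε) - wSum J s g) := by
    refine wSum_mono (G := 2 * G) (G' := G * (1 + ε) + 2 * G) (hJ.abs_wSum_le hGg)
      (fun t => (abs_sub _ _).trans (add_le_add (hc2 t) (hJ.abs_wSum_le hg t))) fun s => ?_
    rw [wSum_sub hc hg, wSum_const]
    have := mul_le_mul_of_nonneg_left (hJ.norm_le_sphere s) hG
    linarith
  rw [wSum_sub hc2 (hJ.abs_wSum_le hg), wSum_const] at h2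
  rw [wSum_sub hc hg, wSum_const] at h1
  have h3 : ‖J x‖ ≤ 1 + ε := by simpa [hx] using hJ.norm_le x
  have h4 : 1 ≤ ‖J x‖ := by simpa [hx] using hJ.le_norm x
  have h5 : G * (1 + ε) * ‖J x‖ ≤ G * (1 + ε) * (1 + ε) :=
    mul_le_mul_of_nonneg_left h3 (mul_nonneg hG (by linarith [hJ.nonneg]))
  have h6 : G * 1 ≤ G * ‖J x‖ := mul_le_mul_of_nonneg_left h4 hG
  have h7 : G * (ε * ε) ≤ G * ε := mul_le_mul_of_nonneg_left
    (by nlinarith [hJ.nonneg, hJ.le_one]) hG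
  nlinarith

end IsSection

end Sections

section Concentration

variable {P : Type} [NormedAddCommGroup P] [NormedSpace ℂ P]
  {J K : P →L[ℂ] l1Space (Metric.sphere (0 : P) 1)} {ε κ : ℝ} {x v w : P}

/-- The part of the norm of `K v` carried by the complement of the finite set `F`. -/
def tailSum (K : P →L[ℂ] l1Space (Metric.sphere (0 : P) 1))
    (F : Set (Metric.sphere (0 : P) 1)) (v : P) : ℝ :=
  wSum K v (Fᶜ.indicator fun _ => 1)

/-- The deviation of the measure `J v` from being concentrated on the circle through `v`. -/
def deviation (J : P →L[ℂ] l1Space (Metric.sphere (0 : P) 1)) (v : P) : ℝ :=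
  ∑' s : Metric.sphere (0 : P) 1, ‖J v s • (s : P) - (‖J v s‖ : ℂ) • v‖

lemma abs_indicator_one_le {S : Type} (F : Set S) (t : S) :
    |F.indicator (fun _ => (1 : ℝ)) t| ≤ 1 := by
  by_cases h : t ∈ F <;> simp [h]

lemma indicator_one_nonneg {S : Type} (F : Set S) (t : S) :
    0 ≤ F.indicator (fun _ => (1 : ℝ)) t :=
  Set.indicator_nonneg (fun _ _ => zero_le_one) t

lemma wSum_indicator_finset (F : Finset (Metric.sphere (0 : P) 1)) (v : P) :
    wSum K v ((F : Set (Metric.sphere (0 : P) 1)).indicator fun _ => 1) = ∑ t ∈ F, ‖K v t‖ := by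
  rw [wSum, tsum_eq_sum (s := F)]
  · exact Finset.sum_congr rfl fun t ht => by simp [ht]
  · intro t ht
    simp [ht]

lemma sum_add_tailSum (F : Finset (Metric.sphere (0 : P) 1)) (v : P) :
    ∑ t ∈ F, ‖K v t‖ + tailSum K F v = ‖K v‖ := by
  rw [← wSum_indicator_finset, tailSum,
    ← wSum_add (abs_indicator_one_le _) (abs_indicator_one_le _), ← one_mul ‖K v‖, ← wSum_const]
  congr 1
  funext t
  by_cases h : t ∈ F <;> simp [h]

lemma tailSum_nonneg (F : Set (Metric.sphere (0 : P) 1)) (v : P) : 0 ≤ tailSum K F v :=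
  wSum_nonneg (indicator_one_nonneg _)

lemma tailSum_sub_le (F : Set (Metric.sphere (0 : P) 1)) (a b : ℂ) (v w : P) :
    tailSum K F (a • v - b • w) ≤ ‖a‖ * tailSum K F v + ‖b‖ * tailSum K F w := by
  have h := wSum_add_left_le (J := K) (v := a • v) (w := (-b) • w)
    (indicator_one_nonneg Fᶜ) (abs_indicator_one_le Fᶜ)
  rwa [neg_smul, ← sub_eq_add_neg, ← neg_smul, wSum_smul_left, wSum_smul_left, norm_neg] at h

lemma summable_deviation (J : P →L[ℂ] l1Space (Metric.sphere (0 : P) 1)) (v w : P) :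
    Summable (fun s : Metric.sphere (0 : P) 1 => ‖J v s • (s : P) - (‖J v s‖ : ℂ) • w‖) := by
  refine Summable.of_nonneg_of_le (fun _ => norm_nonneg _) (fun s => ?_)
    ((l1Space.summable_norm (J v)).mul_right (1 + ‖w‖))
  refine (norm_sub_le _ _).trans ?_
  rw [norm_smul, norm_smul, norm_sphere, Complex.norm_real, norm_norm]
  linarith

lemma deviation_nonneg (J : P →L[ℂ] l1Space (Metric.sphere (0 : P) 1)) (v : P) :
    0 ≤ deviation J v :=
  tsum_nonneg fun _ => norm_nonneg _

lemma norm_functional_sub_le {m α : ℝ} {z a b : ℂ} (hz : ‖z‖ = m) (hα : 0 < α) :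
    ‖z * a - m * b‖ ≤ α / 2 * m + 1 / (2 * α) *
      (m * ‖a‖ ^ 2 - 2 * ((starRingEnd ℂ) b * (z * a)).re + m * ‖b‖ ^ 2) := by
  have hm : 0 ≤ m := hz ▸ norm_nonneg z
  set τ := m * ‖a‖ ^ 2 - 2 * ((starRingEnd ℂ) b * (z * a)).re + m * ‖b‖ ^ 2 with hτ
  rcases hm.eq_or_lt with h0 | h0
  · have hz0 : z = 0 := norm_eq_zero.1 (hz.trans h0.symm)
    simp [hτ, ← h0, hz0]
  · have hsq : ‖z * a - m * b‖ ^ 2 = m * τ := by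
      have h1 : ‖z * a‖ ^ 2 = m ^ 2 * ‖a‖ ^ 2 := by rw [norm_mul, hz, mul_pow]
      have h2 : ‖(m : ℂ) * b‖ ^ 2 = m ^ 2 * ‖b‖ ^ 2 := by
        rw [norm_mul, Complex.norm_real, Real.norm_of_nonneg hm, mul_pow]
      rw [← Complex.normSq_eq_norm_sq, Complex.normSq_sub, Complex.normSq_eq_norm_sq,
        Complex.normSq_eq_norm_sq, h1, h2, hτ]
      have h3 : (z * a * (starRingEnd ℂ) (m * b)).re
          = m * ((starRingEnd ℂ) b * (z * a)).re := by
        rw [map_mul, Complex.conj_ofReal, mul_left_comm, Complex.re_ofReal_mul, mul_comm (z * a)]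
      rw [h3]
      ring
    have h4 : 2 * α * ‖z * a - m * b‖ ≤ τ + α ^ 2 * m := by
      refine le_of_mul_le_mul_left ?_ h0
      nlinarith [sq_nonneg (‖z * a - m * b‖ - α * m)]
    have h5 : α / 2 * m + 1 / (2 * α) * τ = (τ + α ^ 2 * m) / (2 * α) := by
      field_simp
      ring
    rw [h5, le_div_iff₀ (by positivity)]
    linarith

namespace IsSection

lemma deviation_le_four (hJ : IsSection J ε) (s : Metric.sphere (0 : P) 1) :
    |deviation J s| ≤ 4 := by
  rw [abs_of_nonneg (deviation_nonneg J s)]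
  have h1 : ‖J s‖ ≤ 2 := by simpa [norm_sphere] using hJ.norm_le_two s
  have h2 : deviation J s ≤ ∑' t, ‖J s t‖ * 2 := by
    refine (summable_deviation J s s).tsum_le_tsum (fun t => ?_)
      ((l1Space.summable_norm (J s)).mul_right 2)
    refine (norm_sub_le _ _).trans ?_
    rw [norm_smul, norm_smul, norm_sphere, norm_sphere, Complex.norm_real, norm_norm]
    linarith
  rw [tsum_mul_right, (l1Space.hasSum_norm (J s)).tsum_eq] at h2
  linarith

lemma tailSum_le_two (hK : IsSection K κ) (F : Set (Metric.sphere (0 : P) 1))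
    (s : Metric.sphere (0 : P) 1) : |tailSum K F s| ≤ 2 := by
  have h := hK.abs_wSum_le (abs_indicator_one_le Fᶜ) s
  rwa [mul_one] at h

lemma tsum_functional_le (hJ : IsSection J ε) (f : P →L[ℂ] ℂ) {α : ℝ} (hα : 0 < α)
    (s : Metric.sphere (0 : P) 1) :
    Summable (fun t => ‖J s t * f t - (‖J s t‖ : ℂ) * f s‖) ∧
    ∑' t, ‖J s t * f t - (‖J s t‖ : ℂ) * f s‖ ≤ α / 2 * (1 + ε) + 1 / (2 * α) *
      (wSum J s (fun t => ‖f t‖ ^ 2) - ‖f s‖ ^ 2 + ε * ‖f s‖ ^ 2) := by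
  have hf : ∀ t : Metric.sphere (0 : P) 1, |‖f t‖ ^ 2| ≤ ‖f‖ ^ 2 := fun t => by
    rw [abs_of_nonneg (by positivity)]
    have := f.le_opNorm t
    rw [norm_sphere, mul_one] at this
    gcongr
  have h1 : HasSum (fun t => ‖J s t‖ * ‖f t‖ ^ 2) (wSum J s (fun t => ‖f t‖ ^ 2)) :=
    (wSum_summable J s hf).hasSum
  have h2 : HasSum (fun t => ((starRingEnd ℂ) (f s) * (J s t * f t)).re) (‖f s‖ ^ 2) := by
    have := (f.hasSum (hJ.hasSum s)).mul_left ((starRingEnd ℂ) (f s))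
    have h := Complex.hasSum_re this
    rw [← Complex.normSq_eq_conj_mul_self, Complex.ofReal_re, Complex.normSq_eq_norm_sq] at h
    simpa using h
  have h3 : HasSum (fun t => ‖J s t‖ * ‖f s‖ ^ 2) (‖J s‖ * ‖f s‖ ^ 2) :=
    (l1Space.hasSum_norm (J s)).mul_right _
  have h4 := ((l1Space.hasSum_norm (J s)).mul_left (α / 2)).add
    (((h1.sub (h2.mul_left 2)).add h3).mul_left (1 / (2 * α)))
  have h5 := fun t => norm_functional_sub_le (z := J s t) (a := f t) (b := f s) rfl hα
  have h6 : Summable (fun t => ‖J s t * f t - (‖J s t‖ : ℂ) * f s‖) :=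
    Summable.of_nonneg_of_le (fun _ => norm_nonneg _) h5 h4.summable
  refine ⟨h6, (h6.tsum_le_of_sum_le fun F => (F.sum_le_sum fun t _ => h5 t).trans
    (sum_le_hasSum F (fun t _ => (norm_nonneg _).trans (h5 t)) h4)).trans ?_⟩
  have h7 := hJ.norm_le_sphere s
  have h8 : ‖J s‖ * ‖f s‖ ^ 2 ≤ (1 + ε) * ‖f s‖ ^ 2 := by gcongr
  exact add_le_add (mul_le_mul_of_nonneg_left h7 (by positivity))
    (mul_le_mul_of_nonneg_left (by linarith) (by positivity))

/-- On average, a section of norm close to one is concentrated as seen by a functional. -/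
lemma wSum_tsum_functional_le (hJ : IsSection J ε) (f : P →L[ℂ] ℂ)
    (hf : ∀ s : Metric.sphere (0 : P) 1, ‖f s‖ ≤ 2) {α : ℝ} (hα : 0 < α) (hx : ‖x‖ = 1) :
    wSum J x (fun s => α / 2 * (1 + ε) + 1 / (2 * α) *
      (wSum J s (fun t => ‖f t‖ ^ 2) - ‖f s‖ ^ 2 + ε * ‖f s‖ ^ 2)) ≤ 2 * α + 10 * ε / α := by
  have hε := hJ.nonneg
  have hε1 := hJ.le_one
  have hf2 : ∀ s : Metric.sphere (0 : P) 1, |‖f s‖ ^ 2| ≤ 4 := fun s => by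
    rw [abs_of_nonneg (by positivity)]
    nlinarith [hf s, norm_nonneg (f s)]
  have hb1 := hJ.abs_wSum_le hf2
  have hb2 : ∀ s : Metric.sphere (0 : P) 1,
      |wSum J s (fun t => ‖f t‖ ^ 2) - ‖f s‖ ^ 2| ≤ 2 * 4 + 4 := fun s =>
    (abs_sub _ _).trans (add_le_add (hb1 s) (hf2 s))
  have hb3 : ∀ s : Metric.sphere (0 : P) 1, |ε * ‖f s‖ ^ 2| ≤ 1 * 4 := fun s => by
    rw [abs_mul, abs_of_nonneg hε]
    exact mul_le_mul hε1 (hf2 s) (abs_nonneg _) zero_le_one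
  have hb4 : ∀ s : Metric.sphere (0 : P) 1,
      |wSum J s (fun t => ‖f t‖ ^ 2) - ‖f s‖ ^ 2 + ε * ‖f s‖ ^ 2| ≤ 2 * 4 + 4 + 1 * 4 := fun s =>
    (abs_add_le _ _).trans (add_le_add (hb2 s) (hb3 s))
  have hb5 : ∀ s : Metric.sphere (0 : P) 1, |1 / (2 * α) * (wSum J s (fun t => ‖f t‖ ^ 2) -
      ‖f s‖ ^ 2 + ε * ‖f s‖ ^ 2)| ≤ 1 / (2 * α) * (2 * 4 + 4 + 1 * 4) := fun s => by
    rw [abs_mul, abs_of_pos (by positivity : 0 < 1 / (2 * α))]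
    exact mul_le_mul_of_nonneg_left (hb4 s) (by positivity)
  have h1 := hJ.wSum_wSum_le (g := fun t => ‖f t‖ ^ 2) (fun t => by positivity) hf2 hx
  have h2 : wSum J x (fun t => ‖f t‖ ^ 2) ≤ 8 := by
    refine (wSum_le hf2).trans ?_
    have := hJ.norm_le_two x
    rw [hx] at this
    linarith
  have h3 : ‖J x‖ ≤ 2 := by simpa [hx] using hJ.norm_le_two x
  rw [wSum_add (G := |α / 2 * (1 + ε)|) (fun _ => le_rfl) hb5, wSum_const,
    wSum_const_mul, wSum_add hb2 hb3, wSum_sub hb1 hf2, wSum_const_mul]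
  have h4 : α / 2 * (1 + ε) * ‖J x‖ ≤ α / 2 * 2 * 2 := by
    gcongr
    linarith
  have h5 : ε * wSum J x (fun t => ‖f t‖ ^ 2) ≤ ε * 8 := by gcongr
  have h6 : 1 / (2 * α) * (wSum J x (fun s => wSum J s (fun t => ‖f t‖ ^ 2))
      - wSum J x (fun t => ‖f t‖ ^ 2) + ε * wSum J x (fun t => ‖f t‖ ^ 2))
      ≤ 1 / (2 * α) * (20 * ε) := by
    gcongr
    linarith
  have h7 : 1 / (2 * α) * (20 * ε) = 10 * ε / α := by field_simp; ring
  linarith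

lemma deviation_le (hJ : IsSection J ε) (hK : IsSection K κ)
    (F : Finset (Metric.sphere (0 : P) 1)) {α : ℝ} (hα : 0 < α) (s : Metric.sphere (0 : P) 1) :
    deviation J s ≤ ∑ r ∈ F, (α / 2 * (1 + ε) + 1 / (2 * α) *
      (wSum J s (fun t => ‖K t r‖ ^ 2) - ‖K s r‖ ^ 2 + ε * ‖K s r‖ ^ 2))
      + (wSum J s (fun t => tailSum K F t) + 2 * tailSum K F s) := by
  let f : Metric.sphere (0 : P) 1 → P →L[ℂ] ℂ := fun r =>
    (lp.evalCLM ℂ (fun _ : Metric.sphere (0 : P) 1 => ℂ) 1 r).comp K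
  have hf : ∀ r v, f r v = K v r := fun _ _ => rfl
  have hsum := fun r => hJ.tsum_functional_le (f r) hα s
  have hT : HasSum (fun t => ‖J s t‖ * tailSum K F t) (wSum J s (fun t => tailSum K F t)) :=
    (wSum_summable J s (hK.tailSum_le_two F)).hasSum
  have hS := (l1Space.hasSum_norm (J s)).mul_right (tailSum K F s)
  have hle : ∀ t : Metric.sphere (0 : P) 1, ‖J s t • (t : P) - (‖J s t‖ : ℂ) • (s : P)‖ ≤
      ∑ r ∈ F, ‖J s t * f r t - (‖J s t‖ : ℂ) * f r s‖
        + (‖J s t‖ * tailSum K F t + ‖J s t‖ * tailSum K F s) := fun t => by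
    refine (hK.le_norm _).trans ?_
    rw [← sum_add_tailSum F]
    refine add_le_add (le_of_eq (Finset.sum_congr rfl fun r _ => ?_)) ?_
    · rw [← hf, map_sub, map_smul, map_smul, smul_eq_mul, smul_eq_mul]
    · simpa using tailSum_sub_le (K := K) F (J s t) (‖J s t‖ : ℂ) (t : P) (s : P)
  have htot : HasSum (fun t => ∑ r ∈ F, ‖J s t * f r t - (‖J s t‖ : ℂ) * f r s‖
      + (‖J s t‖ * tailSum K F t + ‖J s t‖ * tailSum K F s)) _ :=
    (hasSum_sum fun r _ => (hsum r).1.hasSum).add (hT.add hS)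
  refine (hasSum_le hle (summable_deviation J s s).hasSum htot).trans ?_
  refine add_le_add (Finset.sum_le_sum fun r _ => (hsum r).2) (add_le_add le_rfl ?_)
  refine mul_le_mul_of_nonneg_right ?_ (tailSum_nonneg _ _)
  simpa [norm_sphere] using hJ.norm_le_two s

lemma wSum_deviation_le (hJ : IsSection J ε) (hK : IsSection K κ)
    (F : Finset (Metric.sphere (0 : P) 1)) {α : ℝ} (hα : 0 < α) (hx : ‖x‖ = 1) :
    wSum J x (fun s => deviation J s) ≤ F.card * (2 * α + 10 * ε / α)
      + (6 * ε + 3 * wSum J x (fun s => tailSum K F s)) := by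
  have hε := hJ.nonneg
  have hε1 := hJ.le_one
  let g : Metric.sphere (0 : P) 1 → Metric.sphere (0 : P) 1 → ℝ := fun r s =>
    α / 2 * (1 + ε) + 1 / (2 * α) *
      (wSum J s (fun t => ‖K t r‖ ^ 2) - ‖K s r‖ ^ 2 + ε * ‖K s r‖ ^ 2)
  have hK2 : ∀ s r : Metric.sphere (0 : P) 1, ‖K s r‖ ≤ 2 := fun s r =>
    (lp.norm_apply_le_norm one_ne_zero (K s) r).trans
      (by simpa [norm_sphere] using hK.norm_le_two s)
  have hK4 : ∀ s r : Metric.sphere (0 : P) 1, |‖K s r‖ ^ 2| ≤ 4 := fun s r => by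
    rw [abs_of_nonneg (by positivity)]
    nlinarith [hK2 s r, norm_nonneg (K s r)]
  have hg : ∀ r s, |g r s| ≤ |α / 2 * (1 + ε)| + |1 / (2 * α)| * (2 * 4 + 4 + ε * 4) :=
    fun r s => by
      refine (abs_add_le _ _).trans (add_le_add le_rfl ?_)
      rw [abs_mul]
      refine mul_le_mul_of_nonneg_left ?_ (abs_nonneg _)
      refine (abs_add_le _ _).trans (add_le_add ((abs_sub _ _).trans (add_le_add
        (hJ.abs_wSum_le (fun t => hK4 t r) s) (hK4 s r))) ?_)
      rw [abs_mul, abs_of_nonneg hε]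
      exact mul_le_mul_of_nonneg_left (hK4 s r) hε
  have hgF : ∀ s, |∑ r ∈ F, g r s| ≤ ∑ _r ∈ F, _ := fun s =>
    (Finset.abs_sum_le_sum_abs _ _).trans (Finset.sum_le_sum fun r _ => hg r s)
  have hT := hK.tailSum_le_two F
  have hT2 := hJ.abs_wSum_le hT
  have hT3 : ∀ s : Metric.sphere (0 : P) 1, |2 * tailSum K F s| ≤ 2 * 2 := fun s => by
    rw [abs_mul, abs_two]
    exact mul_le_mul_of_nonneg_left (hT s) zero_le_two
  have hTT : ∀ s : Metric.sphere (0 : P) 1,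
      |wSum J s (fun t => tailSum K F t) + 2 * tailSum K F s| ≤ 2 * 2 + 2 * 2 := fun s =>
    (abs_add_le _ _).trans (add_le_add (hT2 s) (hT3 s))
  refine (wSum_mono hJ.deviation_le_four
    (fun s => (abs_add_le _ _).trans (add_le_add (hgF s) (hTT s)))
    (hJ.deviation_le hK F hα)).trans ?_
  rw [wSum_add hgF hTT, wSum_add hT2 hT3, wSum_const_mul, wSum_finsetSum F (fun r _ => hg r)]
  refine add_le_add ?_ ?_
  · rw [← nsmul_eq_mul]
    refine Finset.sum_le_card_nsmul _ _ _ fun r _ => ?_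
    exact hJ.wSum_tsum_functional_le
      ((lp.evalCLM ℂ (fun _ : Metric.sphere (0 : P) 1 => ℂ) 1 r).comp K) (fun s => hK2 s r) hα hx
  · have := hJ.wSum_wSum_le (g := fun t => tailSum K F t) (fun t => tailSum_nonneg _ _) hT hx
    linarith

/-- The measures given by sections of norm close to one are uniformly tight. -/
lemma wSum_tailSum_le (hJ : IsSection J ε) (hK : IsSection K κ)
    (F : Finset (Metric.sphere (0 : P) 1)) (hx : ‖x‖ = 1) (hF : 1 - κ ≤ ∑ t ∈ F, ‖K x t‖) :
    wSum J x (fun s => tailSum K F s) ≤ ε + 3 * κ := by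
  have hε := hJ.nonneg
  have hε1 := hJ.le_one
  have hκ := hK.nonneg
  have hb := hK.abs_wSum_le (abs_indicator_one_le (F : Set (Metric.sphere (0 : P) 1)))
  have h1 := hJ.wSum_le_wSum_wSum hK
    (indicator_one_nonneg (F : Set (Metric.sphere (0 : P) 1))) (abs_indicator_one_le _) x
  rw [wSum_indicator_finset] at h1
  have hc : ∀ s : Metric.sphere (0 : P) 1, |(fun _ => 1 + κ) s| ≤ 1 + κ :=
    fun _ => (abs_of_nonneg (by linarith)).le
  have h2 : wSum J x (fun s => tailSum K F s) ≤ wSum J x (fun s => (1 + κ) -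
      wSum K s ((F : Set (Metric.sphere (0 : P) 1)).indicator fun _ => 1)) := by
    refine wSum_mono (hK.tailSum_le_two F)
      (fun s => (abs_sub _ _).trans (add_le_add (hc s) (hb s))) fun s => ?_
    rw [wSum_indicator_finset]
    linarith [sum_add_tailSum (K := K) F (s : P), hK.norm_le_sphere s]
  rw [wSum_sub hc hb, wSum_const] at h2
  have h3 : ‖J x‖ ≤ 1 + ε := by simpa [hx] using hJ.norm_le x
  have h4 : (1 + κ) * ‖J x‖ ≤ (1 + κ) * (1 + ε) := by gcongr
  have h5 : κ * ε ≤ κ * 1 := by gcongr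
  linarith

end IsSection

end Concentration

/-! ### Banach spaces with almost isometric sections are `l₁`-spaces -/

section Atoms

variable {P : Type} [NormedAddCommGroup P] [NormedSpace ℂ P]

lemma IsSection.deviation_le_add {K : P →L[ℂ] l1Space (Metric.sphere (0 : P) 1)} {κ : ℝ}
    (hK : IsSection K κ) (v w : Metric.sphere (0 : P) 1) :
    deviation K v ≤ deviation K w + 6 * ‖(v : P) - w‖ := by
  have h1 := (l1Space.hasSum_norm (K (v - w))).mul_right 2
  have h2 := (l1Space.hasSum_norm (K v)).mul_right ‖(v : P) - w‖
  have h3 := (summable_deviation K (w : P) w).hasSum.add (h1.add h2)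
  have h7 : deviation K v ≤ deviation K w + (‖K (v - w)‖ * 2 + ‖K v‖ * ‖(v : P) - w‖) := by
    refine hasSum_le (fun t => ?_) (summable_deviation K (v : P) v).hasSum h3
    have e1 : K v t • (t : P) - (‖K v t‖ : ℂ) • (v : P) =
        (K w t • (t : P) - (‖K w t‖ : ℂ) • (w : P)) + (K (v - w) t • (t : P)
          + (((‖K w t‖ - ‖K v t‖ : ℝ) : ℂ) • (w : P) - (‖K v t‖ : ℂ) • ((v : P) - w))) := by
      rw [map_sub, lp.coeFn_sub, Pi.sub_apply]
      push_cast
      module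
    have e2 : ‖(((‖K w t‖ - ‖K v t‖ : ℝ) : ℂ) • (w : P))‖ ≤ ‖K (v - w) t‖ := by
      rw [norm_smul, norm_sphere, mul_one, Complex.norm_real, Real.norm_eq_abs, map_sub,
        lp.coeFn_sub, Pi.sub_apply, norm_sub_rev]
      exact abs_norm_sub_norm_le _ _
    have e3 : ‖K (v - w) t • (t : P)‖ = ‖K (v - w) t‖ := by
      rw [norm_smul, norm_sphere, mul_one]
    have e4 : ‖(‖K v t‖ : ℂ) • ((v : P) - w)‖ = ‖K v t‖ * ‖(v : P) - w‖ := by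
      rw [norm_smul, Complex.norm_real, norm_norm]
    rw [e1]
    refine (norm_add_le _ _).trans (add_le_add le_rfl ((norm_add_le _ _).trans ?_))
    have := norm_sub_le (((‖K w t‖ - ‖K v t‖ : ℝ) : ℂ) • (w : P)) ((‖K v t‖ : ℂ) • ((v : P) - w))
    linarith
  have h4 := hK.norm_le_two (v - w)
  have h5 : ‖K v‖ ≤ 2 := by simpa [norm_sphere] using hK.norm_le_two v
  have h6 : ‖K v‖ * ‖(v : P) - w‖ ≤ 2 * ‖(v : P) - w‖ := by gcongr
  linarith

lemma IsSection.exists_finset {K : P →L[ℂ] l1Space (Metric.sphere (0 : P) 1)} {κ : ℝ}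
    (hK : IsSection K κ) (hκ : 0 < κ) {x : P} (hx : ‖x‖ = 1) :
    ∃ F : Finset (Metric.sphere (0 : P) 1), 1 - κ ≤ ∑ t ∈ F, ‖K x t‖ := by
  have h : 1 - κ < ‖K x‖ := by linarith [hK.le_norm x]
  obtain ⟨F, hF⟩ := ((l1Space.hasSum_norm (K x)).eventually (lt_mem_nhds h)).exists
  exact ⟨F, hF.le⟩

/-- Two unit vectors on different circles carry almost disjoint concentrated measures. -/
lemma min_le_deviation_terms {v w s : P} {δ : ℝ}
    (hδ : ∀ z : ℂ, ‖z‖ = 1 → δ ≤ ‖v - z • w‖) (a b : ℂ) :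
    δ * min ‖a‖ ‖b‖ ≤ ‖a • s - (‖a‖ : ℂ) • v‖ + ‖b • s - (‖b‖ : ℂ) • w‖ := by
  wlog hab : ‖a‖ ≤ ‖b‖ generalizing a b v w
  · rw [min_comm, add_comm]
    refine this (fun z hz => ?_) b a (le_of_not_ge hab)
    have hz0 : z ≠ 0 := norm_ne_zero_iff.1 (by rw [hz]; exact one_ne_zero)
    have h := hδ z⁻¹ (by rw [norm_inv, hz, inv_one])
    have e : w - z • v = (-z) • (v - z⁻¹ • w) := by
      rw [smul_sub, smul_smul, neg_mul, mul_inv_cancel₀ hz0]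
      module
    rwa [e, norm_smul, norm_neg, hz, one_mul]
  rw [min_eq_left hab]
  rcases eq_or_ne a 0 with rfl | ha
  · simp
  have ha0 : 0 < ‖a‖ := norm_pos_iff.2 ha
  have hb0 : 0 < ‖b‖ := ha0.trans_le hab
  have hb : b ≠ 0 := norm_pos_iff.1 hb0
  have hac : (‖a‖ : ℂ) ≠ 0 := by exact_mod_cast ha0.ne'
  have hz : ‖a / b * (‖b‖ / ‖a‖ : ℂ)‖ = 1 := by
    rw [norm_mul, norm_div, norm_div, Complex.norm_real, Complex.norm_real, norm_norm, norm_norm]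
    field_simp
  have h1 := mul_le_mul_of_nonneg_left (hδ _ hz) ha0.le
  have e : (‖a‖ : ℂ) • (v - (a / b * (‖b‖ / ‖a‖ : ℂ)) • w)
      = (a / b) • (b • s - (‖b‖ : ℂ) • w) - (a • s - (‖a‖ : ℂ) • v) := by
    have e1 : (‖a‖ : ℂ) * (a / b * (‖b‖ / ‖a‖ : ℂ)) = a / b * ‖b‖ := by field_simp
    have e2 : a / b * b = a := by field_simp
    rw [smul_sub, smul_smul, e1, smul_sub, smul_smul, smul_smul, e2]
    abel
  have h2 : ‖a‖ * ‖v - (a / b * (‖b‖ / ‖a‖ : ℂ)) • w‖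
      = ‖(‖a‖ : ℂ) • (v - (a / b * (‖b‖ / ‖a‖ : ℂ)) • w)‖ := by
    rw [norm_smul, Complex.norm_real, norm_norm]
  rw [h2, e] at h1
  have h3 := norm_sub_le ((a / b) • (b • s - (‖b‖ : ℂ) • w)) (a • s - (‖a‖ : ℂ) • v)
  have h4 : ‖(a / b) • (b • s - (‖b‖ : ℂ) • w)‖ ≤ ‖b • s - (‖b‖ : ℂ) • w‖ := by
    rw [norm_smul, norm_div]
    exact mul_le_of_le_one_left (norm_nonneg _) ((div_le_one hb0).2 hab)
  linarith

/-- The overlap of the measures given by two vectors. -/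
def overlap (J : P →L[ℂ] l1Space (Metric.sphere (0 : P) 1)) (v w : P) : ℝ :=
  ∑' s, min ‖J v s‖ ‖J w s‖

lemma summable_overlap (J : P →L[ℂ] l1Space (Metric.sphere (0 : P) 1)) (v w : P) :
    Summable (fun s => min ‖J v s‖ ‖J w s‖) :=
  Summable.of_nonneg_of_le (fun _ => le_min (norm_nonneg _) (norm_nonneg _))
    (fun _ => min_le_left _ _) (l1Space.summable_norm (J v))

lemma mul_overlap_le (J : P →L[ℂ] l1Space (Metric.sphere (0 : P) 1)) {v w : P} {δ : ℝ}
    (hδ : ∀ z : ℂ, ‖z‖ = 1 → δ ≤ ‖v - z • w‖) :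
    δ * overlap J v w ≤ deviation J v + deviation J w := by
  rw [overlap, ← tsum_mul_left]
  exact hasSum_le (fun s => min_le_deviation_terms hδ _ _)
    ((summable_overlap J v w).mul_left δ).hasSum
    ((summable_deviation J v v).hasSum.add (summable_deviation J w w).hasSum)

lemma sum_norm_le_norm_sum_add {ι : Type*} [DecidableEq ι] (F : Finset ι) (z : ι → ℂ) :
    ∑ i ∈ F, ‖z i‖ ≤ ‖∑ i ∈ F, z i‖ + 2 * ∑ i ∈ F, ∑ k ∈ F.erase i, min ‖z i‖ ‖z k‖ := by
  rcases F.eq_empty_or_nonempty with rfl | hF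
  · simp
  obtain ⟨m, hm, hmax⟩ := F.exists_max_image (fun i => ‖z i‖) hF
  have h1 : ∑ k ∈ F.erase m, min ‖z m‖ ‖z k‖
      ≤ ∑ i ∈ F, ∑ k ∈ F.erase i, min ‖z i‖ ‖z k‖ :=
    Finset.single_le_sum (f := fun i => ∑ k ∈ F.erase i, min ‖z i‖ ‖z k‖)
      (fun i _ => Finset.sum_nonneg fun k _ => le_min (norm_nonneg _) (norm_nonneg _)) hm
  have h2 : ∑ k ∈ F.erase m, min ‖z m‖ ‖z k‖ = ∑ k ∈ F.erase m, ‖z k‖ :=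
    Finset.sum_congr rfl fun k hk => min_eq_right (hmax k (Finset.mem_of_mem_erase hk))
  have h3 : ‖z m‖ ≤ ‖∑ i ∈ F, z i‖ + ‖∑ k ∈ F.erase m, z k‖ := by
    rw [← Finset.add_sum_erase F z hm]
    simpa using norm_sub_le (z m + ∑ k ∈ F.erase m, z k) (∑ k ∈ F.erase m, z k)
  have h4 := norm_sum_le (F.erase m) z
  rw [← Finset.add_sum_erase F (fun i => ‖z i‖) hm]
  linarith

lemma IsSection.sum_norm_le {K : P →L[ℂ] l1Space (Metric.sphere (0 : P) 1)} {κ : ℝ}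
    (hK : IsSection K κ) {ι : Type*} [DecidableEq ι] (F : Finset ι) (a : ι → ℂ)
    (e : ι → Metric.sphere (0 : P) 1) :
    ∑ i ∈ F, ‖a i‖ ≤ (1 + κ) * ‖∑ i ∈ F, a i • (e i : P)‖ +
      2 * ∑ i ∈ F, ∑ k ∈ F.erase i, (∑ j ∈ F, ‖a j‖) * overlap K (e i) (e k) := by
  have h1 : HasSum (fun s => ∑ i ∈ F, ‖a i‖ * ‖K (e i) s‖) (∑ i ∈ F, ‖a i‖ * ‖K (e i)‖) :=
    hasSum_sum fun i _ => (l1Space.hasSum_norm (K (e i))).mul_left _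
  have h2 : HasSum (fun s => ∑ i ∈ F, ∑ k ∈ F.erase i, (∑ j ∈ F, ‖a j‖) *
      min ‖K (e i) s‖ ‖K (e k) s‖)
      (∑ i ∈ F, ∑ k ∈ F.erase i, (∑ j ∈ F, ‖a j‖) * overlap K (e i) (e k)) :=
    hasSum_sum fun i _ => hasSum_sum fun k _ => (summable_overlap K (e i) (e k)).hasSum.mul_left _
  have h3 := (l1Space.hasSum_norm (K (∑ i ∈ F, a i • (e i : P)))).add (h2.mul_left 2)
  have h4 := hasSum_le (fun s => ?_) h1 h3
  · have h5 := hK.norm_le (∑ i ∈ F, a i • (e i : P))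
    have h6 : ∑ i ∈ F, ‖a i‖ ≤ ∑ i ∈ F, ‖a i‖ * ‖K (e i)‖ := Finset.sum_le_sum fun i _ =>
      le_mul_of_one_le_right (norm_nonneg _) ((norm_sphere (e i)).symm.le.trans (hK.le_norm _))
    linarith
  · have h7 := sum_norm_le_norm_sum_add F fun i => a i * K (e i) s
    have h8 : K (∑ i ∈ F, a i • (e i : P)) s = ∑ i ∈ F, a i * K (e i) s := by
      rw [map_sum, lp.coeFn_sum, Finset.sum_apply]
      simp
    have ha : ∀ i ∈ F, ‖a i‖ ≤ ∑ j ∈ F, ‖a j‖ := fun i hi =>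
      Finset.single_le_sum (f := fun j => ‖a j‖) (fun _ _ => norm_nonneg _) hi
    have h9 : ∑ i ∈ F, ∑ k ∈ F.erase i, min ‖a i * K (e i) s‖ ‖a k * K (e k) s‖ ≤
        ∑ i ∈ F, ∑ k ∈ F.erase i, (∑ j ∈ F, ‖a j‖) * min ‖K (e i) s‖ ‖K (e k) s‖ := by
      refine Finset.sum_le_sum fun i hi => Finset.sum_le_sum fun k hk => ?_
      rw [norm_mul, norm_mul, mul_min_of_nonneg _ _ (Finset.sum_nonneg fun _ _ => norm_nonneg _)]
      exact min_le_min (mul_le_mul_of_nonneg_right (ha i hi) (norm_nonneg _))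
        (mul_le_mul_of_nonneg_right (ha k (Finset.mem_of_mem_erase hk)) (norm_nonneg _))
    rw [h8]
    simp only [norm_mul] at h7 h9 ⊢
    linarith

end Atoms

section Grothendieck

variable {P : Type} [NormedAddCommGroup P] [NormedSpace ℂ P]
  {J : ℕ → P →L[ℂ] l1Space (Metric.sphere (0 : P) 1)} {x : P}

lemma tendsto_wSum_deviation (hJ : ∀ n, IsSection (J n) ((1 / 4) ^ n)) (hx : ‖x‖ = 1) :
    Tendsto (fun n => wSum (J n) x (fun s => deviation (J n) s)) atTop (𝓝 0) := by
  rw [Metric.tendsto_atTop']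
  intro δ hδ
  obtain ⟨k, hk⟩ := exists_pow_lt_of_lt_one (show 0 < δ / 18 by positivity)
    (show (1 / 4 : ℝ) < 1 by norm_num)
  obtain ⟨F, hF⟩ := (hJ k).exists_finset (by positivity) hx
  have hlim : Tendsto (fun n : ℕ => F.card * (12 * (1 / 2 : ℝ) ^ n) + 9 * (1 / 4 : ℝ) ^ n) atTop
      (𝓝 (F.card * (12 * 0) + 9 * 0)) :=
    (((tendsto_pow_atTop_nhds_zero_of_lt_one (by norm_num) (by norm_num)).const_mul
      12).const_mul _).add ((tendsto_pow_atTop_nhds_zero_of_lt_one (by norm_num)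
      (by norm_num)).const_mul 9)
  obtain ⟨N, hN⟩ := eventually_atTop.1 (hlim.eventually (gt_mem_nhds
    (show F.card * (12 * 0) + 9 * 0 < δ / 2 by simpa using half_pos hδ)))
  refine ⟨N, fun n hn => ?_⟩
  rw [Real.dist_0_eq_abs, abs_of_nonneg (wSum_nonneg fun s => deviation_nonneg _ _)]
  have h1 := (hJ n).wSum_deviation_le (hJ k) F (α := (1 / 2) ^ n) (by positivity) hx
  have h2 := (hJ n).wSum_tailSum_le (hJ k) F hx hF
  have h3 : 10 * (1 / 4 : ℝ) ^ n / (1 / 2) ^ n = 10 * (1 / 2) ^ n := by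
    rw [mul_div_assoc, ← div_pow]
    norm_num
  rw [h3] at h1
  have h4 := hN n hn.le
  have h5 : (F.card : ℝ) * (2 * (1 / 2) ^ n + 10 * (1 / 2) ^ n) = F.card * (12 * (1 / 2) ^ n) := by
    ring
  linarith

/-- The vectors carrying a large part of the mass of `x` contain, in the limit, an atom. -/
lemma exists_tendsto_deviation [CompleteSpace P] (hJ : ∀ n, IsSection (J n) ((1 / 4) ^ n))
    (hx : ‖x‖ = 1) (U : Ultrafilter ℕ) (hU : (U : Filter ℕ) ≤ atTop)
    (G : Set (Metric.sphere (0 : P) 1)) {δ : ℝ} (hδ : 0 < δ)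
    (hG : ∀ᶠ n in U, δ ≤ wSum (J n) x (G.indicator fun _ => 1)) :
    ∃ (e : Metric.sphere (0 : P) 1) (r : ℕ → Metric.sphere (0 : P) 1), (∀ᶠ n in U, r n ∈ G) ∧
      Tendsto (fun n => (r n : P)) U (𝓝 e) ∧ Tendsto (fun n => deviation (J n) e) U (𝓝 0) := by
  choose F hF using fun k => (hJ k).exists_finset (by positivity) hx
  set d : ℕ → ℝ := fun n => wSum (J n) x (fun s => deviation (J n) s) + (1 / 2) ^ n
  have hd0 : ∀ n, 0 < d n := fun n =>
    add_pos_of_nonneg_of_pos (wSum_nonneg fun s => deviation_nonneg _ _) (by positivity)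
  have hdlim : Tendsto d atTop (𝓝 0) := by
    have h := (tendsto_wSum_deviation hJ hx).add
      (tendsto_pow_atTop_nhds_zero_of_lt_one (r := (1 / 2 : ℝ)) (by norm_num) (by norm_num))
    rwa [add_zero] at h
  let score : ℕ → Metric.sphere (0 : P) 1 → ℝ := fun n s =>
    ∑ k ∈ Finset.range (n + 1), 2 ^ k * tailSum (J k) (F k) s + (d n)⁻¹ * deviation (J n) s
  have htail0 : ∀ k (s : Metric.sphere (0 : P) 1), 0 ≤ (2 : ℝ) ^ k * tailSum (J k) (F k) s :=
    fun k s => mul_nonneg (by positivity) (tailSum_nonneg _ _)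
  have hdev0 : ∀ n (s : Metric.sphere (0 : P) 1), 0 ≤ (d n)⁻¹ * deviation (J n) s :=
    fun n s => mul_nonneg (inv_nonneg.2 (hd0 n).le) (deviation_nonneg _ _)
  have hscore : ∀ n, wSum (J n) x (score n) ≤ 9 := by
    intro n
    have hb1 : ∀ k ∈ Finset.range (n + 1), ∀ s : Metric.sphere (0 : P) 1,
        |2 ^ k * tailSum (J k) (F k) s| ≤ 2 ^ k * 2 := fun k _ s => by
      rw [abs_mul, abs_of_pos (by positivity : (0 : ℝ) < 2 ^ k)]
      exact mul_le_mul_of_nonneg_left ((hJ k).tailSum_le_two _ s) (by positivity)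
    have hb2 : ∀ s : Metric.sphere (0 : P) 1, |(d n)⁻¹ * deviation (J n) s| ≤ (d n)⁻¹ * 4 :=
      fun s => by
        rw [abs_mul, abs_of_pos (inv_pos.2 (hd0 n))]
        exact mul_le_mul_of_nonneg_left ((hJ n).deviation_le_four s) (inv_nonneg.2 (hd0 n).le)
    have hb3 : ∀ s : Metric.sphere (0 : P) 1,
        |∑ k ∈ Finset.range (n + 1), 2 ^ k * tailSum (J k) (F k) s|
          ≤ ∑ k ∈ Finset.range (n + 1), 2 ^ k * 2 := fun s =>
      (Finset.abs_sum_le_sum_abs _ _).trans (Finset.sum_le_sum fun k hk => hb1 k hk s)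
    have h1 : wSum (J n) x (score n) = ∑ k ∈ Finset.range (n + 1),
        2 ^ k * wSum (J n) x (fun s => tailSum (J k) (F k) s)
        + (d n)⁻¹ * wSum (J n) x (fun s => deviation (J n) s) := by
      rw [← wSum_const_mul, wSum_add hb3 hb2, wSum_finsetSum _ hb1]
      simp only [wSum_const_mul]
    have h2 : (d n)⁻¹ * wSum (J n) x (fun s => deviation (J n) s) ≤ 1 := by
      rw [inv_mul_le_one₀ (hd0 n)]
      exact le_add_of_nonneg_right (by positivity)
    have h3 : ∑ k ∈ Finset.range (n + 1), 2 ^ k * wSum (J n) x (fun s => tailSum (J k) (F k) s)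
        ≤ ∑ k ∈ Finset.range (n + 1), 4 * (1 / 2 : ℝ) ^ k := by
      refine Finset.sum_le_sum fun k hk => ?_
      have h4 := (hJ n).wSum_tailSum_le (hJ k) (F k) hx (hF k)
      have h5 : (1 / 4 : ℝ) ^ n ≤ (1 / 4) ^ k :=
        pow_le_pow_of_le_one (by norm_num) (by norm_num) (Finset.mem_range_succ_iff.1 hk)
      have h6 : (2 : ℝ) ^ k * (1 / 4) ^ k = (1 / 2) ^ k := by rw [← mul_pow]; norm_num
      calc 2 ^ k * wSum (J n) x (fun s => tailSum (J k) (F k) s)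
          ≤ 2 ^ k * (4 * (1 / 4) ^ k) := by gcongr; linarith
        _ = 4 * (1 / 2) ^ k := by rw [← h6]; ring
    have h7 : ∑ k ∈ Finset.range (n + 1), (1 / 2 : ℝ) ^ k ≤ 2 := by
      exact sum_le_hasSum _ (fun _ _ => by positivity) hasSum_geometric_two
    rw [← Finset.mul_sum] at h3
    linarith
  have hscore_le : ∀ n (s : Metric.sphere (0 : P) 1), |score n s| ≤
      ∑ k ∈ Finset.range (n + 1), 2 ^ k * 2 + (d n)⁻¹ * 4 := fun n s => by
    rw [abs_of_nonneg (add_nonneg (Finset.sum_nonneg fun k _ => htail0 k s) (hdev0 n s))]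
    refine add_le_add (Finset.sum_le_sum fun k _ => ?_) ?_
    · exact mul_le_mul_of_nonneg_left ((le_abs_self _).trans ((hJ k).tailSum_le_two _ s))
        (by positivity)
    · exact mul_le_mul_of_nonneg_left ((le_abs_self _).trans ((hJ n).deviation_le_four s))
        (inv_nonneg.2 (hd0 n).le)
  have hex : ∀ n, ∃ r : Metric.sphere (0 : P) 1,
      δ ≤ wSum (J n) x (G.indicator fun _ => 1) → r ∈ G ∧ score n r ≤ 10 / δ := by
    intro n
    by_contra! hcon
    have hn := (hcon ⟨x, mem_sphere_zero_iff_norm.2 hx⟩).1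
    have h1 : wSum (J n) x (fun s => 10 / δ * G.indicator (fun _ => 1) s)
        ≤ wSum (J n) x (score n) := by
      refine wSum_mono (G := 10 / δ) (fun s => ?_) (hscore_le n) fun s => ?_
      · rw [abs_mul, abs_of_pos (by positivity)]
        exact mul_le_of_le_one_right (by positivity) (abs_indicator_one_le _ _)
      · by_cases hs : s ∈ G
        · simpa [hs] using ((hcon s).2 hs).le
        · simpa [hs] using
            add_nonneg (Finset.sum_nonneg fun k _ => htail0 k s) (hdev0 n s)
    rw [wSum_const_mul] at h1
    have h2 : 10 / δ * δ ≤ 10 / δ * wSum (J n) x (G.indicator fun _ => 1) := by gcongr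
    rw [div_mul_cancel₀ _ hδ.ne'] at h2
    linarith [hscore n]
  choose r hr using hex
  have hrG : ∀ᶠ n in U, r n ∈ G := hG.mono fun n hn => (hr n hn).1
  have hrdev : Tendsto (fun n => deviation (J n) (r n)) U (𝓝 0) := by
    have hlim : Tendsto (fun n => d n * (10 / δ)) U (𝓝 0) := by
      simpa using (hdlim.mono_left hU).mul_const (10 / δ)
    refine squeeze_zero' (Eventually.of_forall fun n => deviation_nonneg _ _)
      (hG.mono fun n hn => ?_) hlim
    rw [← inv_mul_le_iff₀ (hd0 n)]
    exact (le_add_of_nonneg_left (Finset.sum_nonneg fun k _ => htail0 k _)).trans (hr n hn).2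
  have hrtail : ∀ k, ∀ᶠ n in U, tailSum (J k) (F k) (r n) ≤ (1 / 2) ^ k * (10 / δ) := by
    intro k
    filter_upwards [hG, hU (eventually_ge_atTop k)] with n hn hkn
    have h1 : 2 ^ k * tailSum (J k) (F k) (r n) ≤ 10 / δ :=
      (Finset.single_le_sum (f := fun k => 2 ^ k * tailSum (J k) (F k) (r n))
        (fun k _ => htail0 k _) (Finset.mem_range_succ_iff.2 hkn)).trans
        ((le_add_of_nonneg_right (hdev0 n _)).trans (hr n hn).2)
    have h2 : (1 / 2 : ℝ) ^ k = (2 ^ k)⁻¹ := by rw [one_div, inv_pow]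
    rwa [h2, ← div_eq_inv_mul, le_div_iff₀' (by positivity)]
  have hlimc : ∀ k t, ∃ c : ℂ, Tendsto (fun n => J k (r n) t) U (𝓝 c) := by
    intro k t
    have hb : ∀ n, J k (r n) t ∈ Metric.closedBall (0 : ℂ) 2 := fun n => by
      rw [mem_closedBall_zero_iff]
      exact (lp.norm_apply_le_norm one_ne_zero _ _).trans
        (by simpa [norm_sphere] using (hJ k).norm_le_two (r n))
    obtain ⟨c, -, hc⟩ := (isCompact_closedBall (0 : ℂ) 2).ultrafilter_le_nhds
      (U.map fun n => J k (r n) t) (by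
        rw [Ultrafilter.coe_map, le_principal_iff, mem_map]
        exact Filter.univ_mem' hb)
    exact ⟨c, hc⟩
  choose c hc using hlimc
  have hcauchy : Cauchy (map (fun n => (r n : P)) (U : Filter ℕ)) := by
    rw [Metric.cauchy_iff]
    refine ⟨inferInstance, fun η hη => ?_⟩
    obtain ⟨k, hk⟩ := exists_pow_lt_of_lt_one (show 0 < η / 4 / (10 / δ) by positivity)
      (show (1 / 2 : ℝ) < 1 by norm_num)
    rw [lt_div_iff₀ (by positivity)] at hk
    have hs : Tendsto (fun n => ∑ t ∈ F k, ‖J k (r n) t - c k t‖) U (𝓝 0) := by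
      have := tendsto_finsetSum (F k) fun t _ => ((hc k t).sub_const (c k t)).norm
      simpa using this
    refine ⟨_, image_mem_map ((hs.eventually (gt_mem_nhds (show 0 < η / 4 by positivity))).and
      (hrtail k)), ?_⟩
    rintro _ ⟨m, ⟨hm1, hm2⟩, rfl⟩ _ ⟨n, ⟨hn1, hn2⟩, rfl⟩
    rw [dist_eq_norm]
    refine ((hJ k).le_norm _).trans_lt ?_
    rw [← sum_add_tailSum (F k)]
    have h1 := tailSum_sub_le (K := J k) (F k) 1 1 (r m : P) (r n)
    rw [one_smul, one_smul, norm_one, one_mul, one_mul] at h1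
    have h2 : ∑ t ∈ F k, ‖J k ((r m : P) - r n) t‖ ≤ ∑ t ∈ F k, ‖J k (r m) t - c k t‖
        + ∑ t ∈ F k, ‖J k (r n) t - c k t‖ := by
      rw [← Finset.sum_add_distrib]
      refine Finset.sum_le_sum fun t _ => ?_
      rw [map_sub, lp.coeFn_sub, Pi.sub_apply, ← sub_sub_sub_cancel_right _ _ (c k t)]
      exact norm_sub_le _ _
    linarith
  obtain ⟨e, he⟩ := CompleteSpace.complete hcauchy
  have he' : Tendsto (fun n => (r n : P)) U (𝓝 e) := he
  have he1 : ‖e‖ = 1 := tendsto_nhds_unique he'.norm (by simp only [norm_sphere, tendsto_const_nhds])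
  refine ⟨⟨e, mem_sphere_zero_iff_norm.2 he1⟩, r, hrG, he', ?_⟩
  have hlim : Tendsto (fun n => deviation (J n) (r n) + 6 * ‖e - r n‖) U (𝓝 0) := by
    simpa using hrdev.add ((he'.const_sub e).norm.const_mul 6)
  exact squeeze_zero (fun n => deviation_nonneg _ _)
    (fun n => (hJ n).deviation_le_add ⟨e, mem_sphere_zero_iff_norm.2 he1⟩ (r n)) hlim

/-- The unit vectors whose measures concentrate on the circle through them. -/
def atoms (J : ℕ → P →L[ℂ] l1Space (Metric.sphere (0 : P) 1)) (U : Ultrafilter ℕ) :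
    Set (Metric.sphere (0 : P) 1) :=
  {e | Tendsto (fun n => deviation (J n) e) U (𝓝 0)}

lemma mem_closure_span_atoms [CompleteSpace P] (hJ : ∀ n, IsSection (J n) ((1 / 4) ^ n))
    (hx : ‖x‖ = 1) (U : Ultrafilter ℕ) (hU : (U : Filter ℕ) ≤ atTop) :
    x ∈ (Submodule.span ℂ (Subtype.val '' atoms J U)).topologicalClosure := by
  set M := (Submodule.span ℂ (Subtype.val '' atoms J U)).topologicalClosure
  have hMc : IsClosed (M : Set P) := Submodule.isClosed_topologicalClosure _
  rw [← SetLike.mem_coe, ← hMc.closure_eq, Metric.mem_closure_iff]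
  intro η hη
  have hδ : 0 < η / 4 := by positivity
  let G : Set (Metric.sphere (0 : P) 1) := {s | ∀ e ∈ atoms J U, η / 4 ≤ ‖(s : P) - e‖}
  obtain ⟨n, hn⟩ : ∃ n, wSum (J n) x (G.indicator fun _ => 1) < η / 4 := by
    by_contra! hcon
    obtain ⟨e, r, h1, h2, h3⟩ :=
      exists_tendsto_deviation hJ hx U hU G hδ (Eventually.of_forall hcon)
    have h4 : Tendsto (fun n => ‖(r n : P) - e‖) U (𝓝 0) := by
      simpa using (h2.sub_const (e : P)).norm
    obtain ⟨n, h5, h6⟩ := (h1.and (h4.eventually (gt_mem_nhds hδ))).exists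
    exact (h5 e h3).not_gt h6
  have hl : ∀ s : Metric.sphere (0 : P) 1, ∃ l : P, l ∈ M ∧ ‖l‖ ≤ 1 ∧
      ‖(s : P) - l‖ ≤ η / 4 + G.indicator (fun _ => 1) s := by
    intro s
    by_cases hs : s ∈ G
    · refine ⟨0, M.zero_mem, by simp, ?_⟩
      simp [hs, hδ.le]
    · simp only [G, Set.mem_ofPred_eq, not_forall, not_le] at hs
      obtain ⟨e, he, hlt⟩ := hs
      refine ⟨e, Submodule.le_topologicalClosure _ (Submodule.subset_span ⟨e, he, rfl⟩),
        (norm_sphere e).le, ?_⟩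
      have := indicator_one_nonneg G s
      linarith
  choose l hlM hl1 hld using hl
  have hsum := l1Lift_hasSum hl1 (J n x)
  refine ⟨l1Lift l 1 hl1 (J n x), hMc.mem_of_tendsto hsum (Eventually.of_forall fun F =>
    M.sum_mem fun s _ => M.smul_mem _ (hlM s)), ?_⟩
  have hdiff := ((hJ n).hasSum x).sub hsum
  have hb := abs_indicator_one_le G
  have hbd : HasSum (fun s => ‖J n x s‖ * (η / 4 + G.indicator (fun _ => 1) s))
      (wSum (J n) x (fun s => η / 4 + G.indicator (fun _ => 1) s)) :=
    (wSum_summable (G := η / 4 + 1) _ _ fun s => (abs_add_le _ _).trans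
      (add_le_add (abs_of_pos hδ).le (hb s))).hasSum
  have h1 := hdiff.norm_le_of_bounded hbd fun s => by
    rw [← smul_sub, norm_smul]
    exact mul_le_mul_of_nonneg_left (hld s) (norm_nonneg _)
  rw [wSum_add (fun _ => (abs_of_pos hδ).le) hb, wSum_const] at h1
  have h2 : ‖J n x‖ ≤ 2 := by simpa [hx] using (hJ n).norm_le_two x
  rw [dist_eq_norm]
  nlinarith

lemma tendsto_overlap {U : Ultrafilter ℕ} {v w : Metric.sphere (0 : P) 1} (hv : v ∈ atoms J U)
    (hw : w ∈ atoms J U) (hvw : ∀ z : ℂ, ‖z‖ = 1 → (v : P) ≠ z • (w : P)) :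
    Tendsto (fun n => overlap (J n) v w) U (𝓝 0) := by
  obtain ⟨z₀, hz₀, hmin⟩ := (isCompact_sphere (0 : ℂ) 1).exists_isMinOn
    (NormedSpace.sphere_nonempty.2 zero_le_one)
    (f := fun z : ℂ => ‖(v : P) - z • (w : P)‖) (by fun_prop)
  have hδ : 0 < ‖(v : P) - z₀ • (w : P)‖ :=
    norm_pos_iff.2 (sub_ne_zero.2 (hvw z₀ (mem_sphere_zero_iff_norm.1 hz₀)))
  have hlim : Tendsto (fun n => ‖(v : P) - z₀ • (w : P)‖⁻¹ *
      (deviation (J n) v + deviation (J n) w)) U (𝓝 0) := by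
    have hv' : Tendsto (fun n => deviation (J n) v) U (𝓝 0) := hv
    simpa using (hv'.add hw).const_mul ‖(v : P) - z₀ • (w : P)‖⁻¹
  refine squeeze_zero (fun n => tsum_nonneg fun s => le_min (norm_nonneg _) (norm_nonneg _))
    (fun n => ?_) hlim
  rw [← div_eq_inv_mul, le_div_iff₀' hδ]
  exact mul_overlap_le (J n) fun z hz => hmin (mem_sphere_zero_iff_norm.2 hz)

lemma norm_sum_atoms (hJ : ∀ n, IsSection (J n) ((1 / 4) ^ n)) {U : Ultrafilter ℕ}
    (hU : (U : Filter ℕ) ≤ atTop) {ι : Type*} (e : ι → Metric.sphere (0 : P) 1)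
    (he : ∀ i, e i ∈ atoms J U)
    (hne : ∀ i k, i ≠ k → ∀ z : ℂ, ‖z‖ = 1 → (e i : P) ≠ z • (e k : P))
    (F : Finset ι) (a : ι → ℂ) : ‖∑ i ∈ F, a i • (e i : P)‖ = ∑ i ∈ F, ‖a i‖ := by
  classical
  refine le_antisymm ((norm_sum_le _ _).trans (Finset.sum_le_sum fun i _ => ?_)) ?_
  · rw [norm_smul, norm_sphere, mul_one]
  have hpow : Tendsto (fun n : ℕ => (1 / 4 : ℝ) ^ n) U (𝓝 0) :=
    (tendsto_pow_atTop_nhds_zero_of_lt_one (by norm_num) (by norm_num)).mono_left hU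
  have hover : Tendsto (fun n => ∑ i ∈ F, ∑ k ∈ F.erase i, (∑ j ∈ F, ‖a j‖) *
      overlap (J n) (e i) (e k)) U (𝓝 (∑ i ∈ F, ∑ k ∈ F.erase i, (∑ j ∈ F, ‖a j‖) * 0)) :=
    tendsto_finsetSum _ fun i _ => tendsto_finsetSum _ fun k hk =>
      (tendsto_overlap (he i) (he k) (hne i k (Finset.ne_of_mem_erase hk).symm)).const_mul _
  have hlim := ((hpow.const_add 1).mul_const ‖∑ i ∈ F, a i • (e i : P)‖).add (hover.const_mul 2)
  simp only [mul_zero, Finset.sum_const_zero, add_zero, one_mul] at hlim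
  exact ge_of_tendsto' hlim fun n => (hJ n).sum_norm_le F a e

/-- A Banach space `P` for which the canonical map `l₁(S) → P` from the unit sphere has sections of
norm arbitrarily close to one is isometrically isomorphic to an `l₁`-space. -/
theorem exists_linearIsometryEquiv_l1Space [CompleteSpace P]
    (hJ : ∀ n, IsSection (J n) ((1 / 4) ^ n)) :
    ∃ Λ : Type, Nonempty (P ≃ₗᵢ[ℂ] l1Space Λ) := by
  let U : Ultrafilter ℕ := hyperfilter ℕ
  have hU : (U : Filter ℕ) ≤ atTop := Nat.hyperfilter_le_atTop
  let R : Setoid (atoms J U) :=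
    { r := fun v w => ∃ z : ℂ, ‖z‖ = 1 ∧ ((v : Metric.sphere (0 : P) 1) : P) = z • (w.1 : P)
      iseqv :=
        { refl := fun v => ⟨1, norm_one, (one_smul _ _).symm⟩
          symm := fun {v w} ⟨z, hz, h⟩ => ⟨z⁻¹, by rw [norm_inv, hz, inv_one], by
            rw [h, smul_smul, inv_mul_cancel₀ (norm_ne_zero_iff.1 (by rw [hz]; exact one_ne_zero)),
              one_smul]⟩
          trans := fun {u v w} ⟨z, hz, h⟩ ⟨z', hz', h'⟩ => ⟨z * z', by rw [norm_mul, hz, hz', one_mul],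
            by rw [h, h', smul_smul]⟩ } }
  let e : Quotient R → Metric.sphere (0 : P) 1 := fun q => q.out.1
  have he : ∀ q, e q ∈ atoms J U := fun q => q.out.2
  have hne : ∀ i k, i ≠ k → ∀ z : ℂ, ‖z‖ = 1 → (e i : P) ≠ z • (e k : P) := by
    intro i k hik z hz h
    refine hik ?_
    rw [← i.out_eq, ← k.out_eq]
    exact Quotient.sound ⟨z, hz, h⟩
  have hbd : ∀ q, ‖(e q : P)‖ ≤ 1 := fun q => (norm_sphere _).le
  let T : l1Space (Quotient R) →ₗᵢ[ℂ] P :=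
    { (l1Lift (fun q => (e q : P)) 1 hbd).toLinearMap with
      norm_map' := fun c => by
        refine tendsto_nhds_unique ((l1Lift_hasSum hbd c).norm) ?_
        simp only [norm_sum_atoms hJ hU e he hne]
        exact l1Space.hasSum_norm c }
  have hTr : IsClosed (LinearMap.range T.toLinearMap : Set P) := by
    rw [LinearMap.coe_range]
    exact T.isometry.isClosedEmbedding.isClosed_range
  have hspan : Submodule.span ℂ (Subtype.val '' atoms J U) ≤ LinearMap.range T.toLinearMap := by
    classical
    rw [Submodule.span_le]
    rintro _ ⟨v, hv, rfl⟩
    obtain ⟨z, hz, h⟩ : (⟨v, hv⟩ : atoms J U) ≈ (Quotient.mk R ⟨v, hv⟩).out :=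
      Quotient.exact (Quotient.out_eq _).symm
    exact ⟨lp.single 1 (Quotient.mk R ⟨v, hv⟩) z,
      (l1Lift_single hbd (Quotient.mk R ⟨v, hv⟩) z).trans h.symm⟩
  have hsurj : Function.Surjective T := by
    intro v
    rcases eq_or_ne v 0 with rfl | hv
    · exact ⟨0, map_zero T⟩
    have hv0 : (‖v‖ : ℂ) ≠ 0 := by exact_mod_cast norm_ne_zero_iff.2 hv
    have h1 : ‖(‖v‖ : ℂ)⁻¹ • v‖ = 1 := norm_smul_inv_norm hv
    obtain ⟨c, hc⟩ := Submodule.topologicalClosure_minimal _ hspan hTr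
      (mem_closure_span_atoms hJ h1 U hU)
    refine ⟨(‖v‖ : ℂ) • c, ?_⟩
    rw [map_smul]
    change (‖v‖ : ℂ) • T.toLinearMap c = v
    rw [hc, smul_smul, mul_inv_cancel₀ hv0, one_smul]
  exact ⟨Quotient R, ⟨(LinearIsometryEquiv.ofSurjective T hsurj).symm⟩⟩

end Grothendieck

/-! ### Coordinates in modules over a sequence algebra -/

section Coordinates

set_option linter.unusedSectionVars false

lemma SequenceAlgebra.p_mul (n : ℕ) (a : A) : SA.p n * a = SA.coords a n • SA.p n := by
  refine SA.coords_injective (funext fun m => ?_)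
  rw [SA.coords_mul, map_smul, Pi.mul_apply, Pi.smul_apply, SA.coords_p]
  by_cases h : m = n
  · subst h; simp
  · simp [h]

lemma SequenceAlgebra.norm_coords_le (n : ℕ) (a : A) : ‖SA.coords a n‖ ≤ ‖a‖ := by
  have h := norm_mul_le (SA.p n) a
  rwa [SA.p_mul, norm_smul, SA.norm_p, mul_one, one_mul] at h

variable (M : NormedMod A) {M' : NormedMod A}

/-- The projection of a module onto its `n`-th coordinate subspace. -/
def coordProj (n : ℕ) : M.X →L[ℂ] M.X :=
  (M.smulLM (SA.p n)).mkContinuous 1 fun x => by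
    have h := M.norm_smul_le (SA.p n) x
    rwa [SA.norm_p] at h

variable {M}

lemma norm_coordProj_le (n : ℕ) (x : M.X) : ‖coordProj SA M n x‖ ≤ ‖x‖ := by
  have h := M.norm_smul_le (SA.p n) x
  rwa [SA.norm_p, one_mul] at h

lemma coordProj_smul (n : ℕ) (a : A) (x : M.X) :
    coordProj SA M n (M.smul a x) = SA.coords a n • coordProj SA M n x := by
  change M.smul (SA.p n) (M.smul a x) = SA.coords a n • M.smul (SA.p n) x
  rw [← M.mul_smul, SA.p_mul, M.csmul_smul]

lemma coordProj_coordProj (m n : ℕ) (x : M.X) :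
    coordProj SA M m (coordProj SA M n x) = if m = n then coordProj SA M m x else 0 := by
  refine (coordProj_smul SA m (SA.p n) x).trans ?_
  rw [SA.coords_p]
  by_cases h : m = n <;> simp [h]

lemma coordProj_self (n : ℕ) (x : M.X) :
    coordProj SA M n (coordProj SA M n x) = coordProj SA M n x := by
  rw [coordProj_coordProj, if_pos rfl]

lemma coordProj_sum {z : ℕ → M.X} (hz : ∀ n, coordProj SA M n (z n) = z n) (k : ℕ)
    (F : Finset ℕ) : coordProj SA M k (∑ n ∈ F, z n) = if k ∈ F then z k else 0 := by
  rw [map_sum, ← Finset.sum_ite_eq F k z]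
  refine Finset.sum_congr rfl fun n _ => ?_
  rw [← hz n, coordProj_coordProj]
  split_ifs with h
  · rw [← h]
  · rfl

lemma mem_coordSub_iff {n : ℕ} {x : M.X} : x ∈ coordSub SA M n ↔ coordProj SA M n x = x :=
  ⟨fun ⟨y, hy⟩ => hy ▸ coordProj_self SA n y, fun h => ⟨x, h⟩⟩

lemma isClosed_coordSub (n : ℕ) : IsClosed (coordSub SA M n : Set M.X) := by
  have h : (coordSub SA M n : Set M.X) = {x | coordProj SA M n x = x} :=
    Set.ext fun x => mem_coordSub_iff SA
  rw [h]
  exact isClosed_eq (coordProj SA M n).continuous continuous_id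

variable (M) in
/-- The projection of a module onto its `n`-th coordinate subspace, with restricted codomain. -/
def coordProjSub (n : ℕ) : M.X →L[ℂ] coordSub SA M n :=
  (coordProj SA M n).codRestrict (coordSub SA M n) fun x => ⟨x, rfl⟩

lemma coordProjSub_coe (n : ℕ) (x : coordSub SA M n) : coordProjSub SA M n x = x :=
  Subtype.ext ((mem_coordSub_iff SA).1 x.2)

variable {SA}

lemma IsMor.map_coordProj {f : M.X →L[ℂ] M'.X} (hf : IsMor M M' f) (n : ℕ) (x : M.X) :
    f (coordProj SA M n x) = coordProj SA M' n (f x) :=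
  hf (SA.p n) x

namespace Homogeneous

lemma norm_le (hM : Homogeneous SA M) {x y : M.X}
    (h : ∀ n, ‖coordProj SA M n x‖ ≤ ‖coordProj SA M n y‖) : ‖x‖ ≤ ‖y‖ :=
  hM x y h

lemma ext (hM : Homogeneous SA M) {x y : M.X}
    (h : ∀ n, coordProj SA M n x = coordProj SA M n y) : x = y := by
  have h1 : ‖x - y‖ ≤ ‖(0 : M.X)‖ := hM.norm_le fun n => by
    rw [map_sub, h, sub_self, map_zero]
  rwa [norm_zero, norm_le_zero_iff, sub_eq_zero] at h1

lemma norm_sum_coordProj_le (hM : Homogeneous SA M) (F : Finset ℕ) (x : M.X) :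
    ‖∑ n ∈ F, coordProj SA M n x‖ ≤ ‖x‖ := by
  refine hM.norm_le fun k => ?_
  rw [coordProj_sum SA (fun n => coordProj_self SA n x)]
  split_ifs
  · exact le_rfl
  · rw [norm_zero]
    exact norm_nonneg _

/-- In an essential homogeneous module every element is the sum of its coordinates. -/
lemma tendsto_sum_coordProj (hM : Homogeneous SA M) (hess : M.Essential) (x : M.X) :
    Tendsto (fun N => ∑ n ∈ Finset.range N, coordProj SA M n x) atTop (𝓝 x) := by
  let D : Submodule ℂ M.X :=
    { carrier := {x | Tendsto (fun N => ∑ n ∈ Finset.range N, coordProj SA M n x) atTop (𝓝 x)}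
      add_mem' := fun {x y} (hx : Tendsto _ _ _) (hy : Tendsto _ _ _) => by
        refine (hx.add hy).congr fun N => ?_
        simp only [map_add, Finset.sum_add_distrib]
      zero_mem' := by
        change Tendsto _ _ _
        simp only [map_zero, Finset.sum_const_zero, tendsto_const_nhds]
      smul_mem' := fun c x (hx : Tendsto _ _ _) => by
        refine (hx.const_smul c).congr fun N => ?_
        simp only [map_smul, Finset.smul_sum] }
  have hD : IsClosed (D : Set M.X) := by
    refine isClosed_of_closure_subset fun x hx => ?_
    change Tendsto _ _ _
    rw [Metric.tendsto_atTop]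
    intro ε hε
    obtain ⟨y, hy, hxy⟩ := Metric.mem_closure_iff.1 hx (ε / 3) (by positivity)
    obtain ⟨N, hN⟩ := Metric.tendsto_atTop.1
      (show Tendsto (fun N => ∑ n ∈ Finset.range N, coordProj SA M n y) atTop (𝓝 y) from hy)
      (ε / 3) (by positivity)
    refine ⟨N, fun k hk => ?_⟩
    have h1 : dist (∑ n ∈ Finset.range k, coordProj SA M n x)
        (∑ n ∈ Finset.range k, coordProj SA M n y) ≤ dist x y := by
      rw [dist_eq_norm, dist_eq_norm, ← Finset.sum_sub_distrib]
      simp only [← map_sub]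
      exact hM.norm_sum_coordProj_le _ _
    have h2 := hN k hk
    have h3 := dist_triangle4 (∑ n ∈ Finset.range k, coordProj SA M n x)
      (∑ n ∈ Finset.range k, coordProj SA M n y) y x
    rw [dist_comm y x] at h3
    linarith
  have hp : ∀ m (x : M.X), coordProj SA M m x ∈ D := fun m x => by
    refine tendsto_const_nhds.congr' ?_
    filter_upwards [eventually_gt_atTop m] with N hN
    simp only [coordProj_coordProj]
    rw [Finset.sum_ite_eq' (Finset.range N) m, if_pos (Finset.mem_range.2 hN)]
  have hA : ∀ (a : A) (x : M.X), M.smul a x ∈ D := fun a x => by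
    let L : A →L[ℂ] M.X := LinearMap.mkContinuous
      { toFun := fun a => M.smul a x
        map_add' := fun a b => M.add_smul a b x
        map_smul' := fun c a => M.csmul_smul c a x } ‖x‖ fun a =>
          (M.norm_smul_le a x).trans_eq (mul_comm _ _)
    have hspan : Submodule.span ℂ (Set.range SA.p) ≤ D.comap L.toLinearMap := by
      rw [Submodule.span_le]
      rintro _ ⟨m, rfl⟩
      exact hp m x
    have hcl : IsClosed (L ⁻¹' (D : Set M.X)) := hD.preimage L.continuous
    exact closure_minimal hspan hcl (SA.dense_c00 a)
  have hspan : Submodule.span ℂ {y : M.X | ∃ (a : A) (x : M.X), y = M.smul a x} ≤ D := by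
    rw [Submodule.span_le]
    rintro _ ⟨a, x, rfl⟩
    exact hA a x
  exact closure_minimal hspan hD (hess x)

end Homogeneous

end Coordinates

/-! ### Projectivity and the coordinate subspaces -/

section Projectivity

set_option linter.unusedSectionVars false

lemma SequenceAlgebra.coords_p_self (n : ℕ) : SA.coords (SA.p n) n = 1 := by
  rw [SA.coords_p]
  exact if_pos rfl

/-- A normed space as a module supported at the `n`-th coordinate. -/
def scalarMod (n : ℕ) (E : Type) [NormedAddCommGroup E] [NormedSpace ℂ E] : NormedMod A where
  X := E
  smul a x := SA.coords a n • x
  smul_add a x y := smul_add _ x y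
  add_smul a b x := by rw [map_add, Pi.add_apply, add_smul]
  smul_csmul c a x := smul_comm _ c x
  csmul_smul c a x := by rw [map_smul, Pi.smul_apply, smul_assoc]
  mul_smul a b x := by rw [SA.coords_mul, Pi.mul_apply, mul_smul]
  norm_smul_le a x := by
    rw [norm_smul]
    exact mul_le_mul_of_nonneg_right (SA.norm_coords_le n a) (norm_nonneg x)

lemma scalarMod_essential (n : ℕ) (E : Type) [NormedAddCommGroup E] [NormedSpace ℂ E] :
    (scalarMod SA n E).Essential := by
  refine dense_univ.mono fun x _ => Submodule.subset_span ⟨SA.p n, x, ?_⟩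
  change x = SA.coords (SA.p n) n • x
  rw [SA.coords_p_self]
  exact (one_smul ℂ (x : E)).symm

lemma scalarMod_homogeneous (n : ℕ) (E : Type) [NormedAddCommGroup E] [NormedSpace ℂ E] :
    Homogeneous SA (scalarMod SA n E) := by
  intro (x : E) (y : E) h
  have h1 : ‖SA.coords (SA.p n) n • x‖ ≤ ‖SA.coords (SA.p n) n • y‖ := h n
  rw [SA.coords_p_self, one_smul, one_smul] at h1
  exact h1

variable {SA}

/-- The canonical map from `l₁` of the unit sphere of a Banach space is coisometric. -/
lemma isCoisometry_l1Lift_sphere {P : Type} [NormedAddCommGroup P] [NormedSpace ℂ P]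
    [CompleteSpace P] :
    IsCoisometry (l1Lift (fun s : Metric.sphere (0 : P) 1 => (s : P)) 1
      fun s => (norm_sphere s).le) := by
  classical
  refine ⟨fun c => (norm_l1Lift_le _ c).trans_eq (one_mul _), fun x ε hε => ?_⟩
  rcases eq_or_ne x 0 with rfl | hx
  · exact ⟨0, map_zero _, by simpa using hε⟩
  · have hx0 : (‖x‖ : ℂ) ≠ 0 := by exact_mod_cast norm_ne_zero_iff.2 hx
    refine ⟨lp.single 1 ⟨(‖x‖ : ℂ)⁻¹ • x, mem_sphere_zero_iff_norm.2 (norm_smul_inv_norm hx)⟩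
      (‖x‖ : ℂ), ?_, ?_⟩
    · rw [l1Lift_single, smul_smul, mul_inv_cancel₀ hx0, one_smul]
    · rw [l1Space.norm_single, Complex.norm_real, norm_norm]
      linarith

theorem ExtremelyProjective.coordSub_l1Space {X : NormedMod A} [CompleteSpace X.X]
    (hX : ExtremelyProjective X
      (fun M => M.Essential ∧ Homogeneous SA M ∧ CompleteSpace M.X)) (n : ℕ) :
    ∃ Λ : Type, Nonempty (coordSub SA X n ≃ₗᵢ[ℂ] l1Space Λ) := by
  let P : Type := coordSub SA X n
  have : CompleteSpace P := (isClosed_coordSub SA n).completeSpace_coe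
  let S : Type := Metric.sphere (0 : P) 1
  let τ : l1Space S →L[ℂ] P := l1Lift (fun s : Metric.sphere (0 : P) 1 => (s : P)) 1
      fun s => (norm_sphere s).le
  have hφ : IsMor X (scalarMod SA n P) (coordProjSub SA X n) := fun a x =>
    Subtype.ext (coordProj_smul SA n a x)
  have hφ1 : ‖coordProjSub SA X n‖ ≤ 1 := ContinuousLinearMap.opNorm_le_bound _ zero_le_one
    fun x => (norm_coordProj_le SA n x).trans_eq (one_mul _).symm
  have hlift : ∀ m : ℕ, ∃ ψ : X.X →L[ℂ] l1Space S, τ.comp ψ = coordProjSub SA X n ∧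
      ‖ψ‖ ≤ 1 + (1 / 4) ^ m := fun m => by
    obtain ⟨ψ, -, h1, h2⟩ := hX (scalarMod SA n (l1Space S)) (scalarMod SA n P)
      ⟨scalarMod_essential SA n _, scalarMod_homogeneous SA n _,
        inferInstanceAs (CompleteSpace (l1Space S))⟩
      ⟨scalarMod_essential SA n _, scalarMod_homogeneous SA n _, this⟩ τ
      (fun a c => map_smul τ (SA.coords a n) c) (isCoisometry_l1Lift_sphere (P := P))
      (coordProjSub SA X n) hφ ((1 / 4) ^ m) (by positivity)
    exact ⟨ψ, h1, h2.le.trans (add_le_add hφ1 le_rfl)⟩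
  choose ψ hψ1 hψ2 using hlift
  refine exists_linearIsometryEquiv_l1Space (P := P)
    (J := fun m => (ψ m).comp (coordSub SA X n).subtypeL) fun m => ⟨by positivity,
      pow_le_one₀ (by norm_num) (by norm_num), fun v => ?_, fun v => ?_⟩
  · exact (ψ m).le_of_opNorm_le (hψ2 m) v
  · have h := l1Lift_hasSum (fun s : Metric.sphere (0 : P) 1 => (norm_sphere s).le)
      (ψ m (v : X.X))
    have h2 : τ (ψ m (v : X.X)) = v :=
      (DFunLike.congr_fun (hψ1 m) (v : X.X)).trans (coordProjSub_coe SA n v)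
    change HasSum _ (τ (ψ m (v : X.X))) at h
    rwa [h2] at h

/-- Morphisms can be lifted on a coordinate subspace that is an `l₁`-space. -/
lemma exists_coord_lift {X Y Z : NormedMod A} [CompleteSpace Y.X] {n : ℕ} {Λ : Type}
    (T : coordSub SA X n ≃ₗᵢ[ℂ] l1Space Λ) {τ : Y.X →L[ℂ] Z.X} (hτ : IsMor Y Z τ)
    (hco : IsCoisometry τ) {φ : X.X →L[ℂ] Z.X} (hφ : IsMor X Z φ) {C : ℝ} (hC : 1 < C) :
    ∃ (u : X.X) (ψ : X.X →L[ℂ] Y.X), coordProj SA X n u = u ∧ ‖u‖ ≤ 1 ∧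
      (∀ x, coordProj SA Y n (ψ x) = ψ x) ∧ (∀ x, τ (ψ x) = φ (coordProj SA X n x)) ∧
      ∀ x, ‖ψ x‖ ≤ C * ‖φ u‖ * ‖coordProj SA X n x‖ := by
  classical
  set φn : coordSub SA X n →L[ℂ] Z.X := φ.comp (coordSub SA X n).subtypeL
  rcases (norm_nonneg φn).eq_or_lt with h0 | h0
  · have h0' : φn = 0 := φn.opNorm_zero_iff.1 h0.symm
    refine ⟨0, 0, map_zero _, by simp, fun x => by simp, fun x => ?_, fun x => ?_⟩
    · have h : φn (coordProjSub SA X n x) = 0 := by rw [h0']; rfl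
      exact (map_zero τ).trans h.symm
    · simp
  set K := √C
  have hK1 : 1 < K := Real.lt_sqrt_of_sq_lt (by simpa using hC)
  have hKK : K * K = C := Real.mul_self_sqrt (by linarith)
  obtain ⟨u, hu1, hu⟩ := φn.exists_lt_apply_of_lt_opNorm (div_lt_self h0 hK1)
  rw [div_lt_iff₀' (by linarith)] at hu
  let e : Λ → coordSub SA X n := fun i => T.symm (lp.single 1 i 1)
  have he : ∀ i, ‖e i‖ = 1 := fun i => by
    rw [T.symm.norm_map, l1Space.norm_single, norm_one]
  have hy : ∀ i, ∃ y : Y.X, τ y = φn (e i) ∧ ‖y‖ ≤ K * ‖φn‖ := fun i => by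
    obtain ⟨y, h1, h2⟩ := hco.2 (φn (e i)) ((K - 1) * ‖φn‖) (mul_pos (by linarith) h0)
    have h3 := φn.le_opNorm (e i)
    rw [he, mul_one] at h3
    exact ⟨y, h1, by linarith⟩
  choose y hy1 hy2 using hy
  have hb : ∀ i, ‖coordProj SA Y n (y i)‖ ≤ K * ‖φn‖ := fun i =>
    (norm_coordProj_le SA n _).trans (hy2 i)
  let L := l1Lift (fun i => coordProj SA Y n (y i)) (K * ‖φn‖) hb
  have hL1 : ∀ c, coordProj SA Y n (L c) = L c := fun c => by
    refine ((coordProj SA Y n).hasSum (l1Lift_hasSum hb c)).unique ?_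
    simpa only [map_smul, coordProj_self] using l1Lift_hasSum hb c
  have hL2 : ∀ c, τ (L c) = φn (T.symm c) := fun c => by
    have h1 := τ.hasSum (l1Lift_hasSum hb c)
    have h2 := (φn.comp (T.symm.toContinuousLinearEquiv : l1Space Λ →L[ℂ] _)).hasSum
      (l1Space.hasSum_single c)
    refine h1.unique (h2.congr_fun fun i => ?_)
    have h3 : φn (e i) = coordProj SA Z n (φn (e i)) := by
      change φ (e i : X.X) = coordProj SA Z n (φ (e i : X.X))
      rw [← hφ.map_coordProj, (mem_coordSub_iff SA).1 (e i).2]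
    rw [map_smul, map_smul, hτ.map_coordProj, hy1, ← h3]
    rfl
  refine ⟨u, L.comp ((T.toContinuousLinearEquiv : _ →L[ℂ] l1Space Λ).comp (coordProjSub SA X n)),
    (mem_coordSub_iff SA).1 u.2, hu1.le, fun x => hL1 _, fun x => ?_, fun x => ?_⟩
  · refine (hL2 _).trans ?_
    change φn (T.symm (T (coordProjSub SA X n x))) = _
    rw [T.symm_apply_apply]
    rfl
  · refine (norm_l1Lift_le hb _).trans ?_
    change K * ‖φn‖ * ‖T (coordProjSub SA X n x)‖ ≤ C * ‖φn u‖ * ‖coordProjSub SA X n x‖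
    rw [T.norm_map, ← hKK, mul_assoc K K]
    gcongr

theorem extremelyProjective_of_coordSub_l1Space {X : NormedMod A} (hess : X.Essential)
    (hhom : Homogeneous SA X)
    (hl : ∀ n, ∃ Λ : Type, Nonempty (coordSub SA X n ≃ₗᵢ[ℂ] l1Space Λ)) :
    ExtremelyProjective X (fun M => M.Essential ∧ Homogeneous SA M ∧ CompleteSpace M.X) := by
  rintro Y Z ⟨-, hY, hYc⟩ ⟨-, hZ, -⟩ τ hτ hco φ hφ ε hε
  choose Λ hT using hl
  set C : ℝ := 1 + ε / (‖φ‖ + 1)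
  have hC1 : 1 < C := lt_add_of_pos_right _ (by positivity)
  have hC0 : 0 < C := zero_lt_one.trans hC1
  have hCφ : C * ‖φ‖ < ‖φ‖ + ε := by
    have h : ε / (‖φ‖ + 1) * ‖φ‖ < ε := by
      rw [div_mul_eq_mul_div, div_lt_iff₀ (by positivity)]
      nlinarith
    linarith
  choose u ψ hu hu1 hψp hτψ hψ using fun n => exists_coord_lift (hT n).some hτ hco hφ hC1
  have hψ0 : ∀ n x, coordProj SA X n x = 0 → ψ n x = 0 := fun n x h => by
    have := hψ n x
    rwa [h, norm_zero, mul_zero, norm_le_zero_iff] at this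
  have hsum : ∀ (F : Finset ℕ) x, ‖∑ n ∈ F, ψ n x‖ ≤ C * ‖φ‖ * ‖x‖ := by
    intro F x
    set x' := ∑ n ∈ F, (‖coordProj SA X n x‖ : ℂ) • u n
    have hpx' : ∀ k, coordProj SA X k x' =
        if k ∈ F then (‖coordProj SA X k x‖ : ℂ) • u k else 0 :=
      fun k => coordProj_sum SA (z := fun n => (‖coordProj SA X n x‖ : ℂ) • u n)
        (fun n => by rw [map_smul, hu]) k F
    have hx'n : ‖x'‖ ≤ ‖x‖ := hhom.norm_le fun k => by
      rw [hpx']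
      split_ifs
      · rw [norm_smul, Complex.norm_real, norm_norm]
        exact mul_le_of_le_one_right (norm_nonneg _) (hu1 k)
      · rw [norm_zero]
        exact norm_nonneg _
    refine le_of_forall_pos_le_add fun η hη => ?_
    obtain ⟨y, hy1, hy2⟩ := hco.2 (φ x') (η / C) (by positivity)
    have h1 : ‖∑ n ∈ F, ψ n x‖ ≤ ‖(C : ℂ) • y‖ := hY.norm_le fun k => by
      rw [coordProj_sum SA (fun n => hψp n x), map_smul, norm_smul, Complex.norm_real,
        Real.norm_of_nonneg hC0.le]
      split_ifs with hk
      · have h2 : ‖τ (coordProj SA Y k y)‖ = ‖coordProj SA X k x‖ * ‖φ (u k)‖ := by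
          rw [hτ.map_coordProj, hy1, ← hφ.map_coordProj, hpx', if_pos hk, map_smul, norm_smul,
            Complex.norm_real, norm_norm]
        have h3 := hco.1 (coordProj SA Y k y)
        rw [h2] at h3
        calc ‖ψ k x‖ ≤ C * ‖φ (u k)‖ * ‖coordProj SA X k x‖ := hψ k x
          _ = C * (‖coordProj SA X k x‖ * ‖φ (u k)‖) := by ring
          _ ≤ _ := by gcongr
      · rw [norm_zero]
        positivity
    rw [norm_smul, Complex.norm_real, Real.norm_of_nonneg hC0.le] at h1
    calc ‖∑ n ∈ F, ψ n x‖ ≤ C * ‖y‖ := h1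
      _ ≤ C * (‖φ‖ * ‖x‖ + η / C) := by
        gcongr
        exact hy2.le.trans (add_le_add ((φ.le_opNorm x').trans (by gcongr)) le_rfl)
      _ = C * ‖φ‖ * ‖x‖ + η := by field_simp
  have hcauchy : ∀ x, CauchySeq (fun N => ∑ n ∈ Finset.range N, ψ n x) := by
    intro x
    refine cauchySeq_of_le_tendsto_0'
      (fun N => C * ‖φ‖ * ‖x - ∑ n ∈ Finset.range N, coordProj SA X n x‖) (fun N k hNk => ?_) ?_
    · have h1 : ∑ n ∈ Finset.Ico N k, ψ n x = ∑ n ∈ Finset.Ico N k,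
          ψ n (x - ∑ i ∈ Finset.range N, coordProj SA X i x) := by
        refine Finset.sum_congr rfl fun n hn => ?_
        rw [map_sub, hψ0 n (∑ i ∈ Finset.range N, coordProj SA X i x), sub_zero]
        rw [coordProj_sum SA fun i => coordProj_self SA i x, if_neg]
        simpa using (Finset.mem_Ico.1 hn).1
      rw [dist_comm, dist_eq_norm, ← Finset.sum_Ico_eq_sub _ hNk, h1]
      exact hsum _ _
    · simpa using (((hhom.tendsto_sum_coordProj hess x).const_sub x).norm).const_mul (C * ‖φ‖)
  choose Ψ hΨ using fun x => cauchySeq_tendsto_of_complete (hcauchy x)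
  let ΨL : X.X →ₗ[ℂ] Y.X := linearMapOfTendsto Ψ
    (fun N => (∑ n ∈ Finset.range N, ψ n : X.X →L[ℂ] Y.X).toLinearMap)
    (tendsto_pi_nhds.2 fun x => by simpa using hΨ x)
  let Ψc : X.X →L[ℂ] Y.X := ΨL.mkContinuous (C * ‖φ‖) fun x =>
    le_of_tendsto' (hΨ x).norm fun N => hsum _ x
  have hΨp : ∀ k x, coordProj SA Y k (Ψc x) = ψ k x := fun k x => by
    refine tendsto_nhds_unique (((coordProj SA Y k).continuous.tendsto _).comp (hΨ x))
      (tendsto_const_nhds.congr' ?_)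
    filter_upwards [eventually_gt_atTop k] with N hN
    rw [Function.comp_apply, coordProj_sum SA (fun n => hψp n x), if_pos (Finset.mem_range.2 hN)]
  refine ⟨Ψc, fun a x => hY.ext fun k => ?_, ContinuousLinearMap.ext fun x => hZ.ext fun k => ?_,
    (ΨL.mkContinuous_norm_le (by positivity) _).trans_lt hCφ⟩
  · rw [coordProj_smul, hΨp, hΨp, ← sub_eq_zero, ← map_smul, ← map_sub]
    refine hψ0 k _ ?_
    rw [map_sub, coordProj_smul, map_smul, sub_self]
  · rw [ContinuousLinearMap.comp_apply, ← hτ.map_coordProj, hΨp, hτψ, hφ.map_coordProj]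

end Projectivity

/-- Theorem II: an essential homogeneous Banach module `X` over a sequence algebra is
extremely projective with respect to the class `H̄` of essential homogeneous Banach
modules iff every coordinate subspace `Xₙ` is isometrically isomorphic to `l₁(Λₙ)`
for some index set `Λₙ`. -/
theorem theoremII
    (X : NormedMod A) (hess : X.Essential) (hhom : Homogeneous SA X)
    (hcompl : CompleteSpace X.X) :
    ExtremelyProjective X
        (fun M => M.Essential ∧ Homogeneous SA M ∧ CompleteSpace M.X) ↔
      ∀ n : ℕ, ∃ Λ : Type, Nonempty (↥(coordSub SA X n) ≃ₗᵢ[ℂ] l1Space Λ) := by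
  have := hcompl
  exact ⟨fun h n => h.coordSub_l1Space n,
    fun h => extremelyProjective_of_coordSub_l1Space hess hhom h⟩

end
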